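/- Let {P_n}_{n≥0} be a sequence of monic orthogonal polynomials for W_J, and let 𝔇 be a differential operator with matrix polynomial coefficients F_0, …, F_n ∈ Mat_N(ℂ[x]) with F_n ≠ 0, such that for every k ≥ 0 there exists Λ_k ∈ Mat_N(ℂ) with P_k·𝔇 = Λ_k P_k. Then the order n is even, say n = 2m, and the leading coefficient satisfies F_n(x) = c (1−x²)^m I for some c ∈ ℂ. -/

import Mathlib

open Polynomial MeasureTheory Matrix

noncomputable section

abbrev Mat (N : ℕ) := Matrix (Fin N) (Fin N) ℂ

/-- The matrix unit with a `1` in the (1-indexed) entry `(s, t)` and `0` elsewhere. -/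
def EU (N : ℕ) (s t : ℕ) : Mat N :=
  Matrix.of fun p q => if (p : ℕ) + 1 = s ∧ (q : ℕ) + 1 = t then 1 else 0

/-- Evaluation of a matrix polynomial at a real point. -/
def mval {N : ℕ} (P : Polynomial (Mat N)) (x : ℝ) : Mat N :=
  Polynomial.eval ((x : ℂ) • (1 : Mat N)) P

/-- The nilpotent matrix `A = Σ a_{2j-1} E_{2j-1,2j} + Σ a_{2j} E_{2j+1,2j}`. -/
def Amat (N : ℕ) (a : ℕ → ℝ) : Mat N :=
  (∑ j ∈ Finset.Icc 1 (N / 2), (a (2 * j - 1) : ℂ) • EU N (2 * j - 1) (2 * j)) +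
  (∑ j ∈ Finset.Icc 1 ((N - 1) / 2), (a (2 * j) : ℂ) • EU N (2 * j + 1) (2 * j))

/-- `K = Σ_{j=1}^{⌊N/2⌋} E_{2j,2j}`. -/
def Kmat (N : ℕ) : Mat N := ∑ j ∈ Finset.Icc 1 (N / 2), EU N (2 * j) (2 * j)

/-- `T(x) = I + x A`. -/
def Tmat (N : ℕ) (a : ℕ → ℝ) (x : ℝ) : Mat N := 1 + (x : ℂ) • Amat N a

/-- The diagonal Jacobi weight `diag((1−x)^{α₁}(1+x)^{β₁}, …)` (1-indexed `α`, `β`). -/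
def jacobiDiag (N : ℕ) (α β : ℕ → ℝ) (x : ℝ) : Mat N :=
  Matrix.diagonal fun i =>
    (((1 - x) ^ α ((i : ℕ) + 1) * (1 + x) ^ β ((i : ℕ) + 1) : ℝ) : ℂ)

/-- The Jacobi-type weight `W_J(x) = T(x) · diag(…) · T(x)^*`. -/
def WJ (N : ℕ) (a α β : ℕ → ℝ) (x : ℝ) : Mat N :=
  Tmat N a x * jacobiDiag N α β x * (Tmat N a x)ᴴ

/-- The right action `P·𝔇 = Σ_{j=0}^n P^{(j)} F_j` of a differential operator with
matrix-polynomial coefficients `F_0, …, F_n`. -/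
def applyOp {N : ℕ} (F : ℕ → Polynomial (Mat N)) (n : ℕ) (P : Polynomial (Mat N)) :
    Polynomial (Mat N) :=
  ∑ j ∈ Finset.range (n + 1), (fun Q : Polynomial (Mat N) => derivative Q)^[j] P * F j

/-- The scalar Jacobi weight. -/
def jacobiWeight (α β x : ℝ) : ℝ := (1 - x) ^ α * (1 + x) ^ β

lemma jacobiWeight_pos (α β : ℝ) {x : ℝ} (hx : x ∈ Set.Ioo (-1 : ℝ) 1) :
    0 < jacobiWeight α β x := by
  have h1 : 0 < 1 - x := by linarith [hx.2]
  have h2 : 0 < 1 + x := by linarith [hx.1]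
  unfold jacobiWeight
  positivity

lemma continuousOn_jacobiWeight (α β : ℝ) :
    ContinuousOn (jacobiWeight α β) (Set.Ioo (-1 : ℝ) 1) := by
  unfold jacobiWeight
  refine ContinuousOn.mul ?_ ?_
  · refine ContinuousOn.rpow_const (by fun_prop) fun x hx => Or.inl ?_
    have := hx.2
    linarith
  · refine ContinuousOn.rpow_const (by fun_prop) fun x hx => Or.inl ?_
    have := hx.1
    linarith

lemma integrableOn_jacobiWeight {α β : ℝ} (hα : -1 < α) (hβ : -1 < β) :
    IntegrableOn (jacobiWeight α β) (Set.Icc (-1 : ℝ) 1) := by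
  rw [← intervalIntegrable_iff_integrableOn_Icc_of_le (by norm_num)]
  refine IntervalIntegrable.trans (b := 0) ?_ ?_
  · have h : IntervalIntegrable (fun x : ℝ => (1 + x) ^ β) volume (-1) 0 := by
      have := (intervalIntegral.intervalIntegrable_rpow' hβ (a := 0) (b := 1)).comp_add_left 1
      simpa using this
    refine h.continuousOn_mul ?_
    refine ContinuousOn.rpow_const (by fun_prop) fun x hx => Or.inl ?_
    rw [Set.uIcc_of_le (by norm_num)] at hx
    have := hx.2
    linarith
  · have h : IntervalIntegrable (fun x : ℝ => (1 - x) ^ α) volume 0 1 := by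
      have := (intervalIntegral.intervalIntegrable_rpow' hα (a := 1) (b := 0)).comp_sub_left 1
      simpa using this
    refine h.mul_continuousOn ?_
    refine ContinuousOn.rpow_const (by fun_prop) fun x hx => Or.inl ?_
    rw [Set.uIcc_of_le (by norm_num)] at hx
    have := hx.1
    linarith

lemma continuous_eval_ofReal (f : ℂ[X]) : Continuous fun x : ℝ => f.eval (x : ℂ) :=
  f.continuous.comp Complex.continuous_ofReal

lemma integrableOn_eval_mul_jacobiWeight {α β : ℝ} (hα : -1 < α) (hβ : -1 < β) (f : ℂ[X]) :
    IntegrableOn (fun x : ℝ => f.eval (x : ℂ) * (jacobiWeight α β x : ℂ)) (Set.Ioo (-1 : ℝ) 1) := by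
  rw [← integrableOn_Icc_iff_integrableOn_Ioo]
  exact IntegrableOn.continuousOn_mul (continuous_eval_ofReal f).continuousOn
    (integrableOn_jacobiWeight hα hβ).ofReal isCompact_Icc

/-- Integration of polynomials against a Jacobi weight. -/
def jacobiIntegral {α β : ℝ} (hα : -1 < α) (hβ : -1 < β) : ℂ[X] →ₗ[ℂ] ℂ where
  toFun f := ∫ x in Set.Ioo (-1 : ℝ) 1, f.eval (x : ℂ) * (jacobiWeight α β x : ℂ)
  map_add' f g := by
    simp only [eval_add, add_mul]
    exact integral_add (integrableOn_eval_mul_jacobiWeight hα hβ f)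
      (integrableOn_eval_mul_jacobiWeight hα hβ g)
  map_smul' c f := by
    simp only [eval_smul, smul_eq_mul, mul_assoc, RingHom.id_apply]
    exact integral_const_mul _ _

lemma jacobiIntegral_apply {α β : ℝ} (hα : -1 < α) (hβ : -1 < β) (f : ℂ[X]) :
    jacobiIntegral hα hβ f =
      ∫ x in Set.Ioo (-1 : ℝ) 1, f.eval (x : ℂ) * (jacobiWeight α β x : ℂ) := rfl

lemma eq_zero_of_eval_eq_zero_on_Ioo {f : ℂ[X]}
    (h : ∀ x ∈ Set.Ioo (-1 : ℝ) 1, f.eval (x : ℂ) = 0) : f = 0 := by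
  refine Polynomial.eq_zero_of_infinite_isRoot f ?_
  refine Set.Infinite.mono (s := (fun x : ℝ => (x : ℂ)) '' Set.Ioo (-1 : ℝ) 1) ?_ ?_
  · rintro _ ⟨x, hx, rfl⟩
    exact h x hx
  · exact (Set.Ioo_infinite (by norm_num)).image Complex.ofReal_injective.injOn

lemma eval_map_conj_ofReal (f : ℂ[X]) (x : ℝ) :
    (f.map (starRingEnd ℂ)).eval (x : ℂ) = starRingEnd ℂ (f.eval (x : ℂ)) := by
  have := Polynomial.eval_map_apply (f := starRingEnd ℂ) (p := f) (x : ℂ)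
  rwa [Complex.conj_ofReal] at this

lemma re_jacobiIntegral_mul_conj {α β : ℝ} (hα : -1 < α) (hβ : -1 < β) (f : ℂ[X]) :
    (jacobiIntegral hα hβ (f * f.map (starRingEnd ℂ))).re =
      ∫ x in Set.Ioo (-1 : ℝ) 1, ‖f.eval (x : ℂ)‖ ^ 2 * jacobiWeight α β x := by
  have h : jacobiIntegral hα hβ (f * f.map (starRingEnd ℂ)) =
      ((∫ x in Set.Ioo (-1 : ℝ) 1, ‖f.eval (x : ℂ)‖ ^ 2 * jacobiWeight α β x : ℝ) : ℂ) := by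
    rw [jacobiIntegral_apply, ← integral_complex_ofReal]
    refine integral_congr_ae (Filter.Eventually.of_forall fun x => ?_)
    simp [eval_map_conj_ofReal, Complex.mul_conj']
  rw [h, Complex.ofReal_re]

lemma re_jacobiIntegral_mul_conj_nonneg {α β : ℝ} (hα : -1 < α) (hβ : -1 < β) (f : ℂ[X]) :
    0 ≤ (jacobiIntegral hα hβ (f * f.map (starRingEnd ℂ))).re := by
  rw [re_jacobiIntegral_mul_conj]
  refine setIntegral_nonneg measurableSet_Ioo fun x hx => ?_
  have := jacobiWeight_pos α β hx
  positivity

lemma eqOn_zero_of_ae {h : ℝ → ℂ} (hc : ContinuousOn h (Set.Ioo (-1 : ℝ) 1))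
    (h0 : ∀ᵐ x : ℝ, x ∈ Set.Ioo (-1 : ℝ) 1 → h x = 0) :
    ∀ x ∈ Set.Ioo (-1 : ℝ) 1, h x = 0 := by
  have := Measure.eqOn_open_of_ae_eq (μ := volume) (U := Set.Ioo (-1 : ℝ) 1) (f := h)
    (g := fun _ => 0) ((ae_restrict_iff' measurableSet_Ioo).2 h0) isOpen_Ioo hc continuousOn_const
  exact this

lemma eq_zero_of_re_jacobiIntegral_mul_conj {α β : ℝ} (hα : -1 < α) (hβ : -1 < β) {f : ℂ[X]}
    (h : (jacobiIntegral hα hβ (f * f.map (starRingEnd ℂ))).re = 0) : f = 0 := by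
  rw [re_jacobiIntegral_mul_conj, setIntegral_eq_zero_iff_of_nonneg_ae] at h
  · refine eq_zero_of_eval_eq_zero_on_Ioo
      (eqOn_zero_of_ae (continuous_eval_ofReal f).continuousOn ?_)
    rw [Filter.EventuallyEq, ae_restrict_iff' measurableSet_Ioo] at h
    filter_upwards [h] with x hx hxm
    have := (jacobiWeight_pos α β hxm).ne'
    simpa [this] using hx hxm
  · rw [Filter.EventuallyLE, ae_restrict_iff' measurableSet_Ioo]
    refine Filter.Eventually.of_forall fun x hx => ?_
    have := jacobiWeight_pos α β hx
    simp only [Pi.zero_apply]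
    positivity
  · have := (integrableOn_eval_mul_jacobiWeight hα hβ (f * f.map (starRingEnd ℂ))).norm
    refine IntegrableOn.congr_fun this (fun x hx => ?_) measurableSet_Ioo
    have := jacobiWeight_pos α β hx
    simp [eval_map_conj_ofReal, abs_of_pos this, sq]

lemma eq_zero_of_forall_integral_eval_mul_eq_zero {h : ℝ → ℂ}
    (hc : ContinuousOn h (Set.Ioo (-1 : ℝ) 1)) (hi : IntegrableOn h (Set.Ioo (-1 : ℝ) 1))
    (h0 : ∀ f : ℂ[X], ∫ x in Set.Ioo (-1 : ℝ) 1, f.eval (x : ℂ) * h x = 0) :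
    ∀ x ∈ Set.Ioo (-1 : ℝ) 1, h x = 0 := by
  refine eqOn_zero_of_ae hc ?_
  refine isOpen_Ioo.ae_eq_zero_of_integral_contDiff_smul_eq_zero
    hi.locallyIntegrableOn fun g hg _ hgs => ?_
  have hset : ∫ x, g x • h x = ∫ x in Set.Ioo (-1 : ℝ) 1, g x • h x := by
    rw [setIntegral_eq_integral_of_forall_compl_eq_zero]
    intro x hx
    have : x ∉ tsupport g := fun h => hx (hgs h)
    simp [image_eq_zero_of_notMem_tsupport this]
  rw [hset, ← norm_le_zero_iff]
  refine le_of_forall_pos_le_add fun ε hε => ?_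
  set I := ∫ x in Set.Ioo (-1 : ℝ) 1, ‖h x‖ with hI
  have hI0 : 0 ≤ I := integral_nonneg fun x => norm_nonneg _
  have hδ : 0 < ε / (I + 1) := by positivity
  obtain ⟨p, hp⟩ := exists_polynomial_near_of_continuousOn (-1) 1 g hg.continuous.continuousOn _ hδ
  have hpc : ∀ x : ℝ, (p.map (algebraMap ℝ ℂ)).eval (x : ℂ) = ((p.eval x : ℝ) : ℂ) := fun x =>
    Polynomial.eval_map_apply (f := algebraMap ℝ ℂ) (p := p) x
  have hgi : IntegrableOn (fun x => g x • h x) (Set.Ioo (-1 : ℝ) 1) := by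
    have hgc : Continuous fun x => (g x : ℂ) := Complex.continuous_ofReal.comp hg.continuous
    rw [← integrableOn_Icc_iff_integrableOn_Ioo] at hi ⊢
    simpa using IntegrableOn.continuousOn_mul hgc.continuousOn hi isCompact_Icc
  have hpi : IntegrableOn (fun x : ℝ => (p.map (algebraMap ℝ ℂ)).eval (x : ℂ) * h x)
      (Set.Ioo (-1 : ℝ) 1) := by
    rw [← integrableOn_Icc_iff_integrableOn_Ioo] at hi ⊢
    exact IntegrableOn.continuousOn_mul (continuous_eval_ofReal _).continuousOn hi isCompact_Icc
  calc ‖∫ x in Set.Ioo (-1 : ℝ) 1, g x • h x‖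
      = ‖∫ x in Set.Ioo (-1 : ℝ) 1,
          (g x • h x - (p.map (algebraMap ℝ ℂ)).eval (x : ℂ) * h x)‖ := by
        rw [integral_sub hgi hpi, h0, sub_zero]
    _ ≤ ∫ x in Set.Ioo (-1 : ℝ) 1, ε / (I + 1) * ‖h x‖ := by
        refine norm_integral_le_of_norm_le (hi.norm.const_mul _) ?_
        rw [ae_restrict_iff' measurableSet_Ioo]
        refine Filter.Eventually.of_forall fun x hx => ?_
        have h1 := (hp x ⟨hx.1.le, hx.2.le⟩).le
        rw [hpc, Complex.real_smul, ← sub_mul, norm_mul, ← Complex.ofReal_sub, Complex.norm_real,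
          Real.norm_eq_abs, abs_sub_comm]
        gcongr
    _ = ε * (I / (I + 1)) := by
        rw [integral_const_mul]
        ring
    _ ≤ 0 + ε := by
        rw [zero_add]
        refine mul_le_of_le_one_right hε.le ?_
        rw [div_le_one (by positivity)]
        linarith

lemma eval_neg_one_eq_zero_of_rpow_eq {p q : ℂ[X]} {γ γ' s : ℝ} (hs : 0 < s)
    (h : ∀ x ∈ Set.Ioo (-1 : ℝ) 1, p.eval (x : ℂ) * (((1 - x) ^ γ * (1 + x) ^ s : ℝ) : ℂ) =
      q.eval (x : ℂ) * (((1 - x) ^ γ' : ℝ) : ℂ)) : q.eval (-1) = 0 := by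
  have hc : ∀ r : ℝ, ContinuousAt (fun x : ℝ => (1 - x) ^ r) (-1) := fun r =>
    ContinuousAt.rpow_const (by fun_prop) (Or.inl (by norm_num))
  have hl : ContinuousAt (fun x : ℝ => p.eval (x : ℂ) * (((1 - x) ^ γ * (1 + x) ^ s : ℝ) : ℂ))
      (-1) := by
    refine (continuous_eval_ofReal p).continuousAt.mul
      (Complex.continuous_ofReal.continuousAt.comp ((hc γ).mul ?_))
    exact ContinuousAt.rpow_const (by fun_prop) (Or.inr hs.le)
  have hr : ContinuousAt (fun x : ℝ => q.eval (x : ℂ) * (((1 - x) ^ γ' : ℝ) : ℂ)) (-1) :=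
    (continuous_eval_ofReal q).continuousAt.mul
      (Complex.continuous_ofReal.continuousAt.comp (hc γ'))
  have hev : ∀ᶠ x : ℝ in nhdsWithin (-1) (Set.Ioi (-1)),
      p.eval (x : ℂ) * (((1 - x) ^ γ * (1 + x) ^ s : ℝ) : ℂ) =
        q.eval (x : ℂ) * (((1 - x) ^ γ' : ℝ) : ℂ) := by
    filter_upwards [Ioo_mem_nhdsGT (show (-1 : ℝ) < 1 by norm_num)] with x hx using h x hx
  have := tendsto_nhds_unique_of_eventuallyEq (hl.tendsto.mono_left nhdsWithin_le_nhds)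
    (hr.tendsto.mono_left nhdsWithin_le_nhds) hev
  have h2 : (((1 - (-1 : ℝ)) ^ γ' : ℝ) : ℂ) ≠ 0 :=
    Complex.ofReal_ne_zero.2 (Real.rpow_pos_of_pos (by norm_num) _).ne'
  rw [add_neg_cancel, Real.zero_rpow hs.ne', mul_zero, Complex.ofReal_zero, mul_zero] at this
  simpa using (mul_eq_zero.1 this.symm).resolve_right h2

lemma exists_int_sub_eq_of_mul_jacobiWeight_eq {e q : ℂ[X]} (he : e ≠ 0) {α β α' β' : ℝ}
    (h : ∀ x ∈ Set.Ioo (-1 : ℝ) 1, e.eval (x : ℂ) * (jacobiWeight α β x : ℂ) =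
      q.eval (x : ℂ) * (jacobiWeight α' β' x : ℂ)) : ∃ k : ℤ, β' - β = k := by
  have hq : q ≠ 0 := by
    rintro rfl
    refine he (eq_zero_of_eval_eq_zero_on_Ioo fun x hx => ?_)
    have h1 : (jacobiWeight α β x : ℂ) ≠ 0 :=
      Complex.ofReal_ne_zero.2 (jacobiWeight_pos α β hx).ne'
    simpa [h1] using h x hx
  obtain ⟨e₁, he₁, hed⟩ := exists_eq_pow_rootMultiplicity_mul_and_not_dvd e he (-1)
  obtain ⟨q₁, hq₁, hqd⟩ := exists_eq_pow_rootMultiplicity_mul_and_not_dvd q hq (-1)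
  rw [dvd_iff_isRoot] at hed hqd
  set a := rootMultiplicity (-1) e
  set b := rootMultiplicity (-1) q
  have key : ∀ x ∈ Set.Ioo (-1 : ℝ) 1,
      e₁.eval (x : ℂ) * (((1 - x) ^ α * (1 + x) ^ (a + β) : ℝ) : ℂ) =
        q₁.eval (x : ℂ) * (((1 - x) ^ α' * (1 + x) ^ (b + β') : ℝ) : ℂ) := by
    intro x hx
    have hx1 : 0 < 1 + x := by linarith [hx.1]
    have hx2 := h x hx
    rw [he₁, hq₁] at hx2
    simp only [jacobiWeight, eval_mul, eval_pow, eval_sub, eval_X, eval_C, sub_neg_eq_add,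
      Complex.ofReal_mul] at hx2
    rw [Real.rpow_add hx1, Real.rpow_add hx1, Real.rpow_natCast, Real.rpow_natCast]
    push_cast
    linear_combination hx2
  have hsub : ∀ x ∈ Set.Ioo (-1 : ℝ) 1, ∀ r s : ℝ, (1 + x) ^ (r - s) * (1 + x) ^ s = (1 + x) ^ r :=
    fun x hx r s => by rw [← Real.rpow_add (by linarith [hx.1]), sub_add_cancel]
  have hne : ∀ x ∈ Set.Ioo (-1 : ℝ) 1, ∀ s : ℝ, (((1 + x) ^ s : ℝ) : ℂ) ≠ 0 := fun x hx s =>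
    Complex.ofReal_ne_zero.2 (Real.rpow_pos_of_pos (by linarith [hx.1]) _).ne'
  rcases lt_trichotomy ((a : ℝ) + β) (b + β') with hlt | heq | hgt
  · refine absurd (eval_neg_one_eq_zero_of_rpow_eq (p := q₁) (q := e₁) (γ := α') (γ' := α)
      (sub_pos.2 hlt) fun x hx => ?_) hed
    refine mul_right_cancel₀ (hne x hx (a + β)) ?_
    have := key x hx
    rw [← hsub x hx (b + β') (a + β)] at this
    push_cast at this ⊢
    linear_combination -this
  · exact ⟨a - b, by push_cast; linarith⟩
  · refine absurd (eval_neg_one_eq_zero_of_rpow_eq (p := e₁) (q := q₁) (γ := α) (γ' := α')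
      (sub_pos.2 hgt) fun x hx => ?_) hqd
    refine mul_right_cancel₀ (hne x hx (b + β')) ?_
    have := key x hx
    rw [← hsub x hx (a + β) (b + β')] at this
    push_cast at this ⊢
    linear_combination this

lemma eq_zero_of_mul_jacobiWeight_eq {e q : ℂ[X]} {α β α' β' : ℝ}
    (hint : (¬ ∃ k : ℤ, α' - α = (k : ℝ)) ∨ (¬ ∃ k : ℤ, β' - β = (k : ℝ)))
    (h : ∀ x ∈ Set.Ioo (-1 : ℝ) 1, e.eval (x : ℂ) * (jacobiWeight α β x : ℂ) =
      q.eval (x : ℂ) * (jacobiWeight α' β' x : ℂ)) : e = 0 := by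
  by_contra he
  rcases hint with h1 | h1
  · have he' : e.comp (-X) ≠ 0 := by
      rw [Ne, comp_neg_X_eq_zero_iff]
      exact he
    refine h1 (exists_int_sub_eq_of_mul_jacobiWeight_eq (q := q.comp (-X)) (α := β) (α' := β') he'
      fun x hx => ?_)
    have := h (-x) ⟨by linarith [hx.2], by linarith [hx.1]⟩
    simp only [jacobiWeight, sub_neg_eq_add, ← sub_eq_add_neg, Complex.ofReal_neg] at this
    simpa [jacobiWeight, mul_comm] using this
  · exact h1 (exists_int_sub_eq_of_mul_jacobiWeight_eq he h)

lemma eq_zero_of_jacobiIntegral_mul_eq {e q : ℂ[X]} {α β α' β' : ℝ} (hα : -1 < α) (hβ : -1 < β)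
    (hα' : -1 < α') (hβ' : -1 < β')
    (hint : (¬ ∃ k : ℤ, α' - α = (k : ℝ)) ∨ (¬ ∃ k : ℤ, β' - β = (k : ℝ)))
    (h : ∀ f, jacobiIntegral hα hβ (f * e) = jacobiIntegral hα' hβ' (f * q)) : e = 0 := by
  refine eq_zero_of_mul_jacobiWeight_eq (q := q) hint fun x hx => ?_
  rw [← sub_eq_zero]
  have hcw : ∀ γ δ : ℝ, ContinuousOn (fun x => (jacobiWeight γ δ x : ℂ)) (Set.Ioo (-1 : ℝ) 1) :=
    fun γ δ => Complex.continuous_ofReal.comp_continuousOn (continuousOn_jacobiWeight γ δ)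
  refine eq_zero_of_forall_integral_eval_mul_eq_zero
    (h := fun x : ℝ => e.eval (x : ℂ) * (jacobiWeight α β x : ℂ) -
      q.eval (x : ℂ) * (jacobiWeight α' β' x : ℂ)) ?_ ?_ ?_ x hx
  · exact ((continuous_eval_ofReal e).continuousOn.mul (hcw α β)).sub
      ((continuous_eval_ofReal q).continuousOn.mul (hcw α' β'))
  · exact (integrableOn_eval_mul_jacobiWeight hα hβ e).sub
      (integrableOn_eval_mul_jacobiWeight hα' hβ' q)
  · intro f
    have h1 := h f
    rw [jacobiIntegral_apply, jacobiIntegral_apply, ← sub_eq_zero, ← integral_sub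
      (integrableOn_eval_mul_jacobiWeight hα hβ (f * e))
      (integrableOn_eval_mul_jacobiWeight hα' hβ' (f * q))] at h1
    rw [← h1]
    refine integral_congr_ae (Filter.Eventually.of_forall fun x => ?_)
    simp only [eval_mul]
    ring

/-- The first-order coefficient of the Jacobi operator. -/
def jacobiTau (α β : ℝ) : ℂ[X] := C ((β - α : ℝ) : ℂ) - C ((α + β + 2 : ℝ) : ℂ) * X

lemma jacobiIntegral_pearson {α β : ℝ} (hα : -1 < α) (hβ : -1 < β) (f : ℂ[X]) :
    jacobiIntegral hα hβ ((1 - X ^ 2) * derivative f + jacobiTau α β * f) = 0 := by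
  rw [jacobiIntegral_apply, ← integral_Ioc_eq_integral_Ioo,
    ← intervalIntegral.integral_of_le (by norm_num)]
  have hlim : ∀ z : ℝ, (z = -1 ∨ z = 1) → Filter.Tendsto
      (fun x : ℝ => f.eval (x : ℂ) * (jacobiWeight (α + 1) (β + 1) x : ℂ)) (nhds z)
        (nhds 0) := by
    intro z hz
    have hw : Continuous (jacobiWeight (α + 1) (β + 1)) := by
      unfold jacobiWeight
      exact (Continuous.rpow_const (by fun_prop) fun x => Or.inr (by linarith)).mul
        (Continuous.rpow_const (by fun_prop) fun x => Or.inr (by linarith))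
    have := ((continuous_eval_ofReal f).mul (Complex.continuous_ofReal.comp hw)).tendsto z
    have h0 : jacobiWeight (α + 1) (β + 1) z = 0 := by
      have h1 : α + 1 ≠ 0 := by linarith
      have h2 : β + 1 ≠ 0 := by linarith
      rcases hz with rfl | rfl <;> simp [jacobiWeight, Real.zero_rpow, h1, h2]
    rw [Pi.mul_apply, Function.comp_apply, h0, Complex.ofReal_zero, mul_zero] at this
    exact this
  have hderiv : ∀ x ∈ Set.Ioo (-1 : ℝ) 1,
      HasDerivAt (fun x : ℝ => f.eval (x : ℂ) * (jacobiWeight (α + 1) (β + 1) x : ℂ))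
        (((1 - X ^ 2) * derivative f + jacobiTau α β * f).eval (x : ℂ) *
          (jacobiWeight α β x : ℂ)) x := by
    intro x hx
    have hx1 : 0 < 1 - x := by linarith [hx.2]
    have hx2 : 0 < 1 + x := by linarith [hx.1]
    have d1 : HasDerivAt (fun x : ℝ => (1 - x) ^ (α + 1)) (-1 * (α + 1) * (1 - x) ^ α) x := by
      have := ((hasDerivAt_id x).const_sub 1).rpow_const (p := α + 1) (Or.inl hx1.ne')
      simpa using this
    have d2 : HasDerivAt (fun x : ℝ => (1 + x) ^ (β + 1)) (1 * (β + 1) * (1 + x) ^ β) x := by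
      have := ((hasDerivAt_id x).const_add 1).rpow_const (p := β + 1) (Or.inl hx2.ne')
      simpa using this
    have d3 := (f.hasDerivAt (x : ℂ)).comp_ofReal
    have d4 := (d1.mul d2).ofReal_comp
    convert! d3.mul d4 using 1
    simp only [jacobiWeight, jacobiTau, Pi.mul_apply, Real.rpow_add hx1, Real.rpow_add hx2,
      Real.rpow_one, eval_add, eval_mul, eval_sub, eval_one, eval_pow, eval_X, eval_C]
    push_cast
    ring
  have := intervalIntegral.integral_eq_sub_of_hasDerivAt_of_tendsto (show (-1 : ℝ) < 1 by norm_num)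
    hderiv ?_ ((hlim (-1) (Or.inl rfl)).mono_left nhdsWithin_le_nhds)
    ((hlim 1 (Or.inr rfl)).mono_left nhdsWithin_le_nhds)
  · rw [this, sub_zero]
  · rw [intervalIntegrable_iff_integrableOn_Ioo_of_le (by norm_num)]
    exact integrableOn_eval_mul_jacobiWeight hα hβ _

/-- The Jacobi differential operator. -/
def jacobiOp (α β : ℝ) : Module.End ℂ ℂ[X] :=
  Algebra.lmul ℂ ℂ[X] (1 - X ^ 2) * derivative * derivative +
    Algebra.lmul ℂ ℂ[X] (jacobiTau α β) * derivative

lemma jacobiOp_apply (α β : ℝ) (f : ℂ[X]) : jacobiOp α β f =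
    (1 - X ^ 2) * derivative (derivative f) + jacobiTau α β * derivative f := rfl

lemma jacobiIntegral_jacobiOp_mul {α β : ℝ} (hα : -1 < α) (hβ : -1 < β) (f g : ℂ[X]) :
    jacobiIntegral hα hβ (jacobiOp α β f * g) = jacobiIntegral hα hβ (f * jacobiOp α β g) := by
  rw [← sub_eq_zero, ← map_sub,
    ← jacobiIntegral_pearson hα hβ (derivative f * g - f * derivative g)]
  congr 1
  simp only [jacobiOp_apply, derivative_sub, derivative_mul]
  ring

/-- Multiplication operators on `ℂ[X]`. -/
abbrev mulOp : ℂ[X] →ₐ[ℂ] Module.End ℂ ℂ[X] := Algebra.lmul ℂ ℂ[X]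

lemma mulOp_apply (e f : ℂ[X]) : mulOp e f = e * f := rfl

/-- The commutator with multiplication by `X`. -/
def commX : Module.End ℂ (Module.End ℂ ℂ[X]) :=
  LinearMap.mulRight ℂ (mulOp X) - LinearMap.mulLeft ℂ (mulOp X)

lemma commX_eq (E : Module.End ℂ ℂ[X]) : commX E = E * mulOp X - mulOp X * E := rfl

lemma commX_apply (E : Module.End ℂ ℂ[X]) (f : ℂ[X]) : commX E f = E (X * f) - X * E f := rfl

lemma mulOp_comm (e f : ℂ[X]) : mulOp e * mulOp f = mulOp f * mulOp e := by
  rw [← map_mul, mul_comm, map_mul]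

lemma commX_mul (E F : Module.End ℂ ℂ[X]) : commX (E * F) = commX E * F + E * commX F := by
  simp only [commX_eq, sub_mul, mul_sub, mul_assoc]
  abel

lemma commX_mulOp (e : ℂ[X]) : commX (mulOp e) = 0 := by
  rw [commX_eq, mulOp_comm, sub_self]

lemma commX_mulOp_mul (e : ℂ[X]) (E : Module.End ℂ ℂ[X]) :
    commX (mulOp e * E) = mulOp e * commX E := by
  rw [commX_mul, commX_mulOp, zero_mul, zero_add]

lemma commX_mul_mulOp (e : ℂ[X]) (E : Module.End ℂ ℂ[X]) :
    commX (E * mulOp e) = commX E * mulOp e := by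
  rw [commX_mul, commX_mulOp, mul_zero, add_zero]

lemma iterate_commX_mulOp_mul (n : ℕ) (e : ℂ[X]) (E : Module.End ℂ ℂ[X]) :
    commX^[n] (mulOp e * E) = mulOp e * commX^[n] E := by
  induction n generalizing E with
  | zero => rfl
  | succ n ih => rw [Function.iterate_succ_apply, commX_mulOp_mul, ih, Function.iterate_succ_apply]

lemma iterate_commX_mul_mulOp (n : ℕ) (e : ℂ[X]) (E : Module.End ℂ ℂ[X]) :
    commX^[n] (E * mulOp e) = commX^[n] E * mulOp e := by
  induction n generalizing E with
  | zero => rfl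
  | succ n ih => rw [Function.iterate_succ_apply, commX_mul_mulOp, ih, Function.iterate_succ_apply]

lemma commX_derivative : commX (derivative : Module.End ℂ ℂ[X]) = 1 := by
  refine LinearMap.ext fun f => ?_
  rw [commX_apply]
  simp

lemma commX_derivative_pow (j : ℕ) :
    commX ((derivative : Module.End ℂ ℂ[X]) ^ j) = j • derivative ^ (j - 1) := by
  induction j with
  | zero => simp [commX_eq]
  | succ j ih =>
    rw [pow_succ, commX_mul, ih, commX_derivative, mul_one, add_tsub_cancel_right, add_smul,
      one_smul, smul_mul_assoc]
    rcases j with _ | j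
    · simp
    · rw [add_tsub_cancel_right, ← pow_succ]

lemma iterate_commX_sub (n : ℕ) (E F : Module.End ℂ ℂ[X]) :
    commX^[n] (E - F) = commX^[n] E - commX^[n] F :=
  iterate_map_sub commX n E F

lemma iterate_commX_zero (n : ℕ) : commX^[n] 0 = 0 := iterate_map_zero commX n

lemma iterate_commX_sum {ι : Type*} (s : Finset ι) (n : ℕ) (E : ι → Module.End ℂ ℂ[X]) :
    commX^[n] (∑ i ∈ s, E i) = ∑ i ∈ s, commX^[n] (E i) := by
  induction n generalizing E with
  | zero => rfl
  | succ n ih => simp only [Function.iterate_succ_apply, map_sum, ih]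

lemma iterate_commX_derivative_pow (n j : ℕ) :
    commX^[n] ((derivative : Module.End ℂ ℂ[X]) ^ j) = j.descFactorial n • derivative ^ (j - n) := by
  induction n generalizing j with
  | zero => simp
  | succ n ih =>
    rw [Function.iterate_succ_apply', ih, map_nsmul, commX_derivative_pow, smul_smul,
      Nat.descFactorial_succ, mul_comm, Nat.sub_sub]

/-- The operator `∑_{j ≤ n} e_j ∂^j`. -/
def diffOp (n : ℕ) (e : ℕ → ℂ[X]) : Module.End ℂ ℂ[X] :=
  ∑ j ∈ Finset.range (n + 1), mulOp (e j) * derivative ^ j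

lemma iterate_commX_diffOp (n : ℕ) (e : ℕ → ℂ[X]) :
    commX^[n] (diffOp n e) = mulOp (n.factorial • e n) := by
  rw [diffOp, iterate_commX_sum, Finset.sum_eq_single n]
  · rw [iterate_commX_mulOp_mul, iterate_commX_derivative_pow, Nat.descFactorial_self, tsub_self,
      pow_zero, mul_smul_comm, mul_one, map_nsmul]
  · intro j hj hjn
    rw [Finset.mem_range] at hj
    rw [iterate_commX_mulOp_mul, iterate_commX_derivative_pow,
      Nat.descFactorial_of_lt (by omega), zero_smul, mul_zero]
  · intro h
    simp at h

lemma iterate_succ_commX_diffOp (n : ℕ) (e : ℕ → ℂ[X]) : commX^[n + 1] (diffOp n e) = 0 := by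
  rw [Function.iterate_succ_apply', iterate_commX_diffOp, commX_mulOp]

lemma eq_mulOp_of_commX_eq_zero {E : Module.End ℂ ℂ[X]} (h : commX E = 0) : E = mulOp (E 1) := by
  have h1 : ∀ f, E (X * f) = X * E f := fun f => by
    rw [← sub_eq_zero, ← commX_apply, h, LinearMap.zero_apply]
  refine Polynomial.lhom_ext' fun k => LinearMap.ext fun c => ?_
  simp only [LinearMap.comp_apply, mulOp_apply]
  induction k with
  | zero =>
    rw [monomial_zero_left, ← mul_one (C c), ← smul_eq_C_mul, map_smul]
    simp [mul_comm]
  | succ k ih =>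
    rw [← X_mul_monomial, h1, ih]
    ring

/-- `E` has an adjoint as an operator from `ℂ[X]` with functional `u` to `ℂ[X]` with
functional `v`. -/
def HasAdjoint (u v : ℂ[X] →ₗ[ℂ] ℂ) (E : Module.End ℂ ℂ[X]) : Prop :=
  ∀ g, ∃ h, ∀ f, u (E f * g) = v (f * h)

lemma hasAdjoint_commX {u v : ℂ[X] →ₗ[ℂ] ℂ} {E : Module.End ℂ ℂ[X]} (hE : HasAdjoint u v E) :
    HasAdjoint u v (commX E) := by
  intro g
  obtain ⟨h₁, hh₁⟩ := hE g
  obtain ⟨h₂, hh₂⟩ := hE (X * g)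
  refine ⟨X * h₁ - h₂, fun f => ?_⟩
  have e1 : (E (X * f) - X * E f) * g = E (X * f) * g - E f * (X * g) := by ring
  rw [commX_apply, e1, map_sub, hh₁, hh₂, ← map_sub]
  congr 1
  ring

lemma eq_zero_of_hasAdjoint {u v : ℂ[X] →ₗ[ℂ] ℂ}
    (huv : ∀ e q, (∀ f, u (f * e) = v (f * q)) → e = 0) {n : ℕ} {E : Module.End ℂ ℂ[X]}
    (hE : HasAdjoint u v E) (h : commX^[n] E = 0) : E = 0 := by
  induction n generalizing E with
  | zero => exact h
  | succ n ih =>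
    rw [Function.iterate_succ_apply] at h
    have h1 := eq_mulOp_of_commX_eq_zero (ih (hasAdjoint_commX hE) h)
    obtain ⟨q, hq⟩ := hE 1
    have h2 : E 1 = 0 := by
      refine huv _ q fun f => ?_
      rw [← hq, mul_one]
      conv_rhs => rw [h1]
      rw [mulOp_apply, mul_comm]
    rw [h1, h2, map_zero]

lemma mem_degreeLT_of_succ {k : ℕ} {f : ℂ[X]} (hf : f ∈ degreeLT ℂ (k + 1)) (h : f.coeff k = 0) :
    f ∈ degreeLT ℂ k := by
  rw [mem_degreeLT, degree_lt_iff_coeff_zero] at hf ⊢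
  intro m hm
  rcases hm.eq_or_lt with rfl | hm
  · exact h
  · exact hf m hm

lemma exists_sub_smul_mem_degreeLT {E : Module.End ℂ ℂ[X]}
    (hE : ∀ k, ∀ f ∈ degreeLT ℂ k, E f ∈ degreeLT ℂ k) (k : ℕ) :
    ∃ c : ℂ, ∀ f ∈ degreeLT ℂ (k + 1), E f - c • f ∈ degreeLT ℂ k := by
  refine ⟨(E (X ^ k)).coeff k, fun f hf => ?_⟩
  have hr : f - f.coeff k • X ^ k ∈ degreeLT ℂ k := by
    refine mem_degreeLT_of_succ (Submodule.sub_mem _ hf (Submodule.smul_mem _ _ ?_)) (by simp)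
    rw [mem_degreeLT, degree_X_pow]
    exact_mod_cast Nat.lt_succ_self k
  refine mem_degreeLT_of_succ (Submodule.sub_mem _ (hE _ f hf) (Submodule.smul_mem _ _ hf)) ?_
  have h1 := hE k _ hr
  rw [mem_degreeLT, degree_lt_iff_coeff_zero] at h1
  have h2 := h1 k le_rfl
  rw [map_sub, map_smul, coeff_sub, coeff_smul, smul_eq_mul] at h2
  rw [coeff_sub, coeff_smul, smul_eq_mul]
  linear_combination h2

lemma map_conj_mem_degreeLT {k : ℕ} {f : ℂ[X]} (hf : f ∈ degreeLT ℂ k) :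
    f.map (starRingEnd ℂ) ∈ degreeLT ℂ k := by
  rw [mem_degreeLT] at hf ⊢
  exact degree_map_le.trans_lt hf

/-- A degree-preserving operator with a degree-preserving adjoint commutes with every
degree-preserving symmetric operator. -/
lemma commute_of_symmetric {u : ℂ[X] →ₗ[ℂ] ℂ}
    (hu : ∀ f : ℂ[X], u (f * f.map (starRingEnd ℂ)) = 0 → f = 0) {E J : Module.End ℂ ℂ[X]}
    (hE : ∀ k, ∀ f ∈ degreeLT ℂ k, E f ∈ degreeLT ℂ k)
    (hE' : ∀ k, ∀ g ∈ degreeLT ℂ k, ∃ h ∈ degreeLT ℂ k, ∀ f, u (E f * g) = u (f * h))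
    (hJ : ∀ k, ∀ f ∈ degreeLT ℂ k, J f ∈ degreeLT ℂ k)
    (hJ' : ∀ f g, u (J f * g) = u (f * J g)) : E * J = J * E := by
  have key : ∀ k, ∀ f ∈ degreeLT ℂ k, E (J f) - J (E f) = 0 := by
    intro k
    induction k with
    | zero =>
      intro f hf
      have : f = 0 := by simpa [mem_degreeLT] using hf
      simp [this]
    | succ k ih =>
      intro f hf
      obtain ⟨c, hc⟩ := exists_sub_smul_mem_degreeLT hE k
      obtain ⟨d, hd⟩ := exists_sub_smul_mem_degreeLT hJ k
      have h1 : E (J f) - J (E f) ∈ degreeLT ℂ k := by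
        have e1 := hE k _ (hd f hf)
        have e2 := hJ k _ (hc f hf)
        have e3 := Submodule.smul_mem _ d (hc f hf)
        have e4 := Submodule.smul_mem _ c (hd f hf)
        have e5 := Submodule.sub_mem _ (Submodule.add_mem _ e1 e3) (Submodule.add_mem _ e2 e4)
        convert! e5 using 1
        simp only [map_sub, map_smul, smul_sub, smul_smul, mul_comm c d]
        abel
      have h2 : ∀ g ∈ degreeLT ℂ k, u ((E (J f) - J (E f)) * g) = 0 := by
        intro g hg
        obtain ⟨h, hh, hE1⟩ := hE' k g hg
        obtain ⟨h₂, hh₂, hE2⟩ := hE' k _ (hJ k g hg)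
        have h3 : ∀ f, u ((E (J f) - J (E f)) * g) = u (f * (J h - h₂)) := by
          intro f
          rw [sub_mul, map_sub, hE1, hJ', hJ', hE2, mul_sub, map_sub]
        have h4 : J h - h₂ = 0 := by
          refine hu _ ?_
          rw [mul_comm, ← h3, ih, zero_mul, map_zero]
          exact map_conj_mem_degreeLT (Submodule.sub_mem _ (hJ k h hh) hh₂)
        rw [h3, h4, mul_zero, map_zero]
      exact hu _ (h2 _ (map_conj_mem_degreeLT h1))
  refine LinearMap.ext fun f => ?_
  rw [← sub_eq_zero]
  refine key (f.natDegree + 1) f ?_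
  rw [mem_degreeLT]
  exact_mod_cast degree_le_natDegree.trans_lt (by exact_mod_cast Nat.lt_succ_self _)

lemma jacobiOp_eq (α β : ℝ) : jacobiOp α β =
    mulOp (1 - X ^ 2) * derivative ^ 2 + mulOp (jacobiTau α β) * derivative := by
  rw [jacobiOp, pow_two (derivative : Module.End ℂ ℂ[X]), mul_assoc]

lemma commX_jacobiOp (α β : ℝ) : commX (jacobiOp α β) =
    mulOp (2 * (1 - X ^ 2)) * derivative + mulOp (jacobiTau α β) := by
  rw [jacobiOp_eq, map_add, commX_mulOp_mul, commX_mulOp_mul, commX_derivative,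
    commX_derivative_pow, mul_one, mul_smul_comm, map_mul, two_nsmul, map_ofNat]
  simp [two_mul, add_mul]

lemma commX_commX_jacobiOp (α β : ℝ) :
    commX (commX (jacobiOp α β)) = mulOp (2 * (1 - X ^ 2)) := by
  rw [commX_jacobiOp α β, map_add commX, commX_mulOp_mul, commX_derivative, mul_one, commX_mulOp,
    add_zero]

lemma mul_mulOp_sub_mulOp_mul {E : Module.End ℂ ℂ[X]} {e : ℂ[X]} (he : commX E = mulOp e)
    (p : ℂ[X]) : E * mulOp p - mulOp p * E = mulOp (e * derivative p) := by
  have hX : E * mulOp X = mulOp X * E + mulOp e := by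
    rw [← he, commX_eq]
    abel
  induction p using Polynomial.induction_on' with
  | add p q hp hq =>
    rw [derivative_add, mul_add, map_add, map_add, ← hp, ← hq, mul_add, add_mul]
    abel
  | monomial k c =>
    induction k with
    | zero =>
      refine LinearMap.ext fun f => ?_
      simp [← smul_eq_C_mul]
    | succ k ih =>
      rw [← X_mul_monomial, map_mul, ← mul_assoc, hX, add_mul, mul_assoc, mul_assoc,
        ← sub_add_eq_add_sub, ← mul_sub, ih, ← map_mul, ← map_mul, ← map_add, derivative_mul,
        derivative_X]
      congr 1
      ring

lemma iterate_commX_bracket {J : Module.End ℂ ℂ[X]} (hJ : commX (commX (commX J)) = 0) (n : ℕ)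
    (E : Module.End ℂ ℂ[X]) : commX^[n + 1] (E * J - J * E) =
      (commX^[n + 1] E * J - J * commX^[n + 1] E) +
      (n + 1) • (commX^[n] E * commX J - commX J * commX^[n] E) +
      (n + 1).choose 2 •
        (commX^[n - 1] E * commX (commX J) - commX (commX J) * commX^[n - 1] E) := by
  induction n with
  | zero =>
    simp only [zero_add, Function.iterate_one, map_sub, commX_mul, Function.iterate_zero, id,
      one_smul, Nat.choose_succ_self, zero_smul]
    abel
  | succ n ih =>
    rw [Function.iterate_succ_apply', ih]
    simp only [map_add, map_nsmul, map_sub, commX_mul, hJ, ← Function.iterate_succ_apply' commX,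
      mul_zero, zero_mul, add_zero, zero_add, add_tsub_cancel_right]
    have hch : (n + 1 + 1).choose 2 = (n + 1) + (n + 1).choose 2 := by
      rw [Nat.choose_succ_succ' (n + 1) 1, Nat.choose_one_right]
    rw [hch]
    rcases n with _ | n
    · simp only [zero_add, Function.iterate_zero, id, one_smul, Nat.choose_succ_self, zero_smul,
        add_smul, Nat.succ_eq_add_one, Function.iterate_succ_apply']
      abel
    · simp only [Nat.succ_eq_add_one, add_tsub_cancel_right]
      module

/-- The leading coefficient of an operator commuting with the Jacobi operator satisfies a
first-order differential equation. -/
lemma leading_eq_of_commute_jacobiOp {α β : ℝ} {n : ℕ} {E : Module.End ℂ ℂ[X]} {e : ℂ[X]}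
    (he : commX^[n] E = mulOp e) (hc : E * jacobiOp α β = jacobiOp α β * E) :
    (n : ℂ[X]) * X * e + (1 - X ^ 2) * derivative e = 0 := by
  have h1 := iterate_commX_bracket (J := jacobiOp α β)
    (by rw [commX_commX_jacobiOp, commX_mulOp]) n E
  rw [hc, sub_self, iterate_commX_zero, Function.iterate_succ_apply', he, commX_mulOp, zero_mul,
    mul_zero, sub_self, zero_add, commX_commX_jacobiOp, commX_jacobiOp] at h1
  have h2 : mulOp e * (mulOp (2 * (1 - X ^ 2)) * derivative + mulOp (jacobiTau α β)) -
      (mulOp (2 * (1 - X ^ 2)) * derivative + mulOp (jacobiTau α β)) * mulOp e =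
      -mulOp (2 * (1 - X ^ 2) * derivative e) := by
    refine LinearMap.ext fun f => ?_
    simp only [LinearMap.sub_apply, LinearMap.add_apply, Module.End.mul_apply, mulOp_apply,
      LinearMap.neg_apply, derivative_mul]
    ring
  have h3 : (n + 1).choose 2 • (commX^[n - 1] E * mulOp (2 * (1 - X ^ 2)) -
      mulOp (2 * (1 - X ^ 2)) * commX^[n - 1] E) =
      (n + 1).choose 2 • mulOp (e * derivative (2 * (1 - X ^ 2))) := by
    rcases n with _ | n
    · simp
    · rw [mul_mulOp_sub_mulOp_mul]
      rw [add_tsub_cancel_right, ← he, Function.iterate_succ_apply']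
  rw [h2, h3] at h1
  have h4 := congrArg (fun T : Module.End ℂ ℂ[X] => T 1) h1
  have h5 : (2 : ℂ[X]) * ((n + 1).choose 2 : ℕ) = (n + 1) * n := by
    rw [Nat.choose_two_right, ← Nat.cast_ofNat (n := 2), ← Nat.cast_mul,
      Nat.mul_div_cancel' (Nat.even_mul_pred_self _).two_dvd]
    push_cast
    simp
  have h6 : ((n : ℂ[X]) + 1) ≠ 0 := by exact_mod_cast n.succ_ne_zero
  refine mul_left_cancel₀ (mul_ne_zero (neg_ne_zero.2 (two_ne_zero' ℂ[X])) h6) ?_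
  simp only [LinearMap.zero_apply, LinearMap.add_apply, LinearMap.smul_apply, LinearMap.neg_apply,
    mulOp_apply] at h4
  simp only [nsmul_eq_mul, derivative_mul, derivative_sub, derivative_one, derivative_X_pow,
    derivative_ofNat, Nat.cast_ofNat, map_ofNat] at h4
  push_cast at h4
  linear_combination -h4 + 2 * X * e * h5

lemma eq_pow_of_leading_eq {n : ℕ} {e : ℂ[X]} (he : e ≠ 0)
    (h : (n : ℂ[X]) * X * e + (1 - X ^ 2) * derivative e = 0) :
    ∃ m, n = 2 * m ∧ ∃ c : ℂ, e = C c * (1 - X ^ 2) ^ m := by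
  induction n using Nat.strong_induction_on generalizing e with
  | _ n ih =>
    have hρ : (1 - X ^ 2 : ℂ[X]) ≠ 0 := by
      intro h0
      have := congrArg (eval 0) h0
      simp at this
    rcases Nat.eq_zero_or_pos n with rfl | hn
    · refine ⟨0, rfl, e.coeff 0, ?_⟩
      have : derivative e = 0 := by simpa [hρ] using h
      rw [pow_zero, mul_one]
      exact eq_C_of_natDegree_eq_zero (derivative_eq_zero.1 this)
    · have hn' : (n : ℂ) ≠ 0 := by exact_mod_cast hn.ne'
      have r1 : e.IsRoot 1 := by
        have := congrArg (eval 1) h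
        simpa [hn'] using this
      have r2 : e.IsRoot (-1) := by
        have := congrArg (eval (-1)) h
        simpa [hn'] using this
      have hd : (1 - X ^ 2 : ℂ[X]) ∣ e := by
        have hcop : IsCoprime (X - C (1 : ℂ)) (X - C (-1 : ℂ)) :=
          isCoprime_X_sub_C_of_isUnit_sub (by norm_num)
        have := hcop.mul_dvd (dvd_iff_isRoot.2 r1) (dvd_iff_isRoot.2 r2)
        have h2 : (1 - X ^ 2 : ℂ[X]) = -((X - C (1 : ℂ)) * (X - C (-1 : ℂ))) := by
          simp only [map_neg, map_one]
          ring
        rw [h2]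
        exact (neg_dvd).2 this
      obtain ⟨g, rfl⟩ := hd
      have hg : g ≠ 0 := right_ne_zero_of_mul he
      have h' : ((n : ℂ[X]) - 2) * X * g + (1 - X ^ 2) * derivative g = 0 := by
        refine mul_left_cancel₀ hρ ?_
        simp only [derivative_mul, derivative_sub, derivative_one, derivative_X_pow] at h
        simp only [Nat.cast_ofNat, map_ofNat, zero_sub] at h
        linear_combination h
      rcases Nat.lt_or_ge n 2 with h1 | h2
      · exfalso
        obtain rfl : n = 1 := by omega
        have hdeg := congrArg (fun p => coeff p (g.natDegree + 1)) h'
        have e1 : (1 - X ^ 2) * derivative g = derivative g - X * (X * derivative g) := by ring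
        have e2 : (((1 : ℕ) : ℂ[X]) - 2) * X * g = -(X * g) := by
          push_cast
          ring
        have e3 : (derivative g).coeff (g.natDegree + 1) = 0 := by
          rw [coeff_derivative, coeff_eq_zero_of_natDegree_lt (by omega), zero_mul]
        have e4 : (X * derivative g).coeff g.natDegree = g.natDegree * g.leadingCoeff := by
          rcases Nat.eq_zero_or_pos g.natDegree with h0 | h0
          · rw [h0]
            simp
          · obtain ⟨d, hd⟩ := Nat.exists_eq_succ_of_ne_zero h0.ne'
            rw [leadingCoeff, hd, Nat.succ_eq_add_one, coeff_X_mul, coeff_derivative]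
            push_cast
            ring
        rw [e1, e2] at hdeg
        simp only [coeff_add, coeff_neg, coeff_sub, coeff_X_mul, e3, e4, coeff_zero,
          coeff_natDegree] at hdeg
        have h7 : ((g.natDegree : ℂ) + 1) * g.leadingCoeff = 0 := by linear_combination -hdeg
        have h8 : (g.natDegree : ℂ) + 1 ≠ 0 := by exact_mod_cast g.natDegree.succ_ne_zero
        exact hg (leadingCoeff_eq_zero.1 ((mul_eq_zero.1 h7).resolve_left h8))
      · obtain ⟨m, hm, c, rfl⟩ := ih (n - 2) (by omega) hg (by push_cast [h2]; exact h')
        exact ⟨m + 1, by omega, c, by ring⟩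

lemma jacobiOp_mem_degreeLT (α β : ℝ) (k : ℕ) {f : ℂ[X]} (hf : f ∈ degreeLT ℂ k) :
    jacobiOp α β f ∈ degreeLT ℂ k := by
  rw [mem_degreeLT, degree_lt_iff_coeff_zero] at hf ⊢
  intro m hm
  have e : jacobiOp α β f = derivative (derivative f) + C ((β - α : ℝ) : ℂ) * derivative f -
      X * (X * derivative (derivative f)) - C ((α + β + 2 : ℝ) : ℂ) * (X * derivative f) := by
    rw [jacobiOp_apply, jacobiTau]
    ring
  have h2 : (X * derivative f).coeff m = 0 := by
    rcases m with _ | m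
    · simp
    · rw [coeff_X_mul, coeff_derivative, hf _ hm, zero_mul]
  have h3 : (X * (X * derivative (derivative f))).coeff m = 0 := by
    rcases m with _ | _ | m
    · simp
    · simp
    · rw [coeff_X_mul, coeff_X_mul, coeff_derivative, coeff_derivative, hf _ hm, zero_mul,
        zero_mul]
  rw [e, coeff_sub, coeff_sub, coeff_add, coeff_C_mul, coeff_C_mul, h2, h3, coeff_derivative,
    coeff_derivative, coeff_derivative, hf _ (by omega), hf _ (by omega)]
  simp

section Operators

variable {ι : Type*}

/-- The matrix of multiplication on the right by `1 + x A`. -/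
def twist [DecidableEq ι] (A : Matrix ι ι ℂ) : Matrix ι ι ℂ[X] := 1 + Matrix.of fun t s => C (A s t) * X

lemma twist_apply [DecidableEq ι] (A : Matrix ι ι ℂ) (t s : ι) :
    twist A t s = (1 : Matrix ι ι ℂ[X]) t s + C (A s t) * X := rfl

variable [Fintype ι]

/-- The action of a matrix of operators on vectors of polynomials. -/
def opAct (D : Matrix ι ι (Module.End ℂ ℂ[X])) : Module.End ℂ (ι → ℂ[X]) :=
  LinearMap.pi fun t => ∑ s, D t s ∘ₗ LinearMap.proj s

lemma opAct_apply (D : Matrix ι ι (Module.End ℂ ℂ[X])) (v : ι → ℂ[X]) (t : ι) :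
    opAct D v t = ∑ s, D t s (v s) := by
  simp [opAct]

lemma opAct_mul (D E : Matrix ι ι (Module.End ℂ ℂ[X])) (v : ι → ℂ[X]) :
    opAct (D * E) v = opAct D (opAct E v) := by
  ext1 t
  simp only [opAct_apply, Matrix.mul_apply, LinearMap.sum_apply, Module.End.mul_apply, map_sum]
  exact Finset.sum_comm

lemma opAct_single [DecidableEq ι] (D : Matrix ι ι (Module.End ℂ ℂ[X])) (s t : ι) (f : ℂ[X]) :
    opAct D (Pi.single s f) t = D t s f := by
  rw [opAct_apply, Finset.sum_eq_single s]
  · rw [Pi.single_eq_same]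
  · intro r _ hr
    rw [Pi.single_eq_of_ne hr, map_zero]
  · simp

lemma opAct_map_mulOp (τ : Matrix ι ι ℂ[X]) (v : ι → ℂ[X]) :
    opAct (τ.map mulOp) v = τ *ᵥ v := by
  ext1 t
  simp only [opAct_apply, Matrix.map_apply, mulOp_apply, Matrix.mulVec, dotProduct]

lemma exists_forall_mem_degreeLT (v : ι → ℂ[X]) : ∃ k, ∀ i, v i ∈ degreeLT ℂ k := by
  refine ⟨(Finset.univ.sup fun i => (v i).natDegree) + 1, fun i => ?_⟩
  rw [mem_degreeLT]
  refine degree_le_natDegree.trans_lt ?_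
  exact_mod_cast Nat.lt_succ_of_le
    (Finset.le_sup (f := fun i => (v i).natDegree) (Finset.mem_univ i))

/-- Coefficientwise complex conjugation of a vector of polynomials. -/
def conjVec {κ : Type*} (v : κ → ℂ[X]) : κ → ℂ[X] := fun i => (v i).map (starRingEnd ℂ)

lemma conjVec_sum_smul {κ : Type*} (c : ι → ℂ) (v : ι → κ → ℂ[X]) :
    conjVec (∑ m, c m • v m) = ∑ m, (starRingEnd ℂ) (c m) • conjVec (v m) := by
  ext1 i
  simp [conjVec, Polynomial.map_sum, Polynomial.map_smul]

lemma iterate_commX_conj_eq_zero {n : ℕ} {D : Matrix ι ι (Module.End ℂ ℂ[X])}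
    (hD : ∀ t s, commX^[n] (D t s) = 0) (τ τ' : Matrix ι ι ℂ[X]) (t s : ι) :
    commX^[n] ((τ.map mulOp * D * τ'.map mulOp) t s) = 0 := by
  simp only [Matrix.mul_apply, Matrix.map_apply, iterate_commX_sum, iterate_commX_mul_mulOp,
    iterate_commX_mulOp_mul, hD, mul_zero, Finset.sum_const_zero, zero_mul]

/-- The bilinear form `∑ i, u_i ((τ v)_i (τ w)_i)`. -/
def twistForm (u : ι → ℂ[X] →ₗ[ℂ] ℂ) (τ : Matrix ι ι ℂ[X]) :
    (ι → ℂ[X]) →ₗ[ℂ] (ι → ℂ[X]) →ₗ[ℂ] ℂ :=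
  LinearMap.mk₂ ℂ (fun v w => ∑ i, u i ((τ *ᵥ v) i * (τ *ᵥ w) i))
    (fun v v' w => by simp only [mulVec_add, Pi.add_apply, add_mul, map_add,
      Finset.sum_add_distrib])
    (fun c v w => by simp only [mulVec_smul, Pi.smul_apply, smul_mul_assoc, map_smul,
      Finset.smul_sum])
    (fun v w w' => by simp only [mulVec_add, Pi.add_apply, mul_add, map_add,
      Finset.sum_add_distrib])
    (fun c v w => by simp only [mulVec_smul, Pi.smul_apply, mul_smul_comm, map_smul,
      Finset.smul_sum])

lemma twistForm_apply (u : ι → ℂ[X] →ₗ[ℂ] ℂ) (τ : Matrix ι ι ℂ[X]) (v w : ι → ℂ[X]) :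
    twistForm u τ v w = ∑ i, u i ((τ *ᵥ v) i * (τ *ᵥ w) i) := rfl

lemma twistForm_comm (u : ι → ℂ[X] →ₗ[ℂ] ℂ) (τ : Matrix ι ι ℂ[X]) (v w : ι → ℂ[X]) :
    twistForm u τ v w = twistForm u τ w v := by
  simp only [twistForm_apply, mul_comm]

variable [DecidableEq ι]

lemma twistForm_mulVec_single {u : ι → ℂ[X] →ₗ[ℂ] ℂ} {τ τ' : Matrix ι ι ℂ[X]} (h : τ * τ' = 1)
    (v : ι → ℂ[X]) (t : ι) (g : ℂ[X]) :
    twistForm u τ v (τ' *ᵥ Pi.single t g) = u t ((τ *ᵥ v) t * g) := by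
  rw [twistForm_apply, mulVec_mulVec, h, one_mulVec, Finset.sum_eq_single t]
  · rw [Pi.single_eq_same]
  · intro r _ hr
    rw [Pi.single_eq_of_ne hr, mul_zero, map_zero]
  · simp

lemma hasAdjoint_conj {u : ι → ℂ[X] →ₗ[ℂ] ℂ} {τ τ' : Matrix ι ι ℂ[X]} (h : τ * τ' = 1)
    {D : Matrix ι ι (Module.End ℂ ℂ[X])}
    (hD : ∀ w, ∃ w', ∀ v, twistForm u τ (opAct D v) w = twistForm u τ v w') (t s : ι) :
    HasAdjoint (u t) (u s) ((τ.map mulOp * D * τ'.map mulOp) t s) := by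
  intro g
  obtain ⟨w', hw'⟩ := hD (τ' *ᵥ Pi.single t g)
  refine ⟨(τ *ᵥ w') s, fun f => ?_⟩
  have := hw' (τ' *ᵥ Pi.single s f)
  rw [twistForm_mulVec_single h, twistForm_comm, twistForm_mulVec_single h] at this
  rw [← opAct_single, opAct_mul, opAct_mul, opAct_map_mulOp, opAct_map_mulOp, this, mul_comm]

lemma twist_mul_twist_neg {A : Matrix ι ι ℂ} (hA : ∀ r s t, A r s * A s t = 0) :
    twist A * twist (-A) = 1 := by
  have h1 : twist (-A) = 1 - Matrix.of fun t s => C (A s t) * X := by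
    ext1 t s
    simp [twist_apply, sub_eq_add_neg]
  have h2 : (Matrix.of fun t s => C (A s t) * X) * (Matrix.of fun t s => C (A s t) * X) =
      (0 : Matrix ι ι ℂ[X]) := by
    ext1 t s
    rw [Matrix.mul_apply]
    refine Finset.sum_eq_zero fun r _ => ?_
    simp only [of_apply]
    have : C (A r t) * X * (C (A s r) * X) = C (A s r * A r t) * X ^ 2 := by
      rw [C_mul]
      ring
    rw [this, hA, C_0, zero_mul]
  rw [h1, twist, add_mul, one_mul, mul_sub, mul_one, h2]
  abel

lemma twist_neg_mul_twist {A : Matrix ι ι ℂ} (hA : ∀ r s t, A r s * A s t = 0) :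
    twist (-A) * twist A = 1 := by
  have := twist_mul_twist_neg (A := -A) (by simpa using hA)
  rwa [neg_neg] at this

lemma twist_mulVec_apply (A : Matrix ι ι ℂ) (v : ι → ℂ[X]) (t : ι) :
    (twist A *ᵥ v) t = v t + X * ∑ s, C (A s t) * v s := by
  rw [twist, add_mulVec, one_mulVec, Pi.add_apply, Finset.mul_sum]
  congr 1
  simp only [mulVec, dotProduct, of_apply]
  refine Finset.sum_congr rfl fun s _ => ?_
  ring

lemma conj_diagonal_apply {A : Matrix ι ι ℂ} (hA : ∀ r s t, A r s * A s t = 0)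
    (E : ι → Module.End ℂ ℂ[X]) (t s : ι) :
    ((twist (-A)).map mulOp * diagonal E * (twist A).map mulOp) t s =
      diagonal E t s + E t * mulOp (C (A s t) * X) - mulOp (C (A s t) * X) * E s := by
  set M : Matrix ι ι (Module.End ℂ ℂ[X]) := of fun t s => mulOp (C (A s t) * X) with hM
  have h1 : (twist A).map mulOp = 1 + M := by
    ext1 t s
    rw [Matrix.map_apply, twist_apply, map_add, Matrix.add_apply, Matrix.one_apply,
      Matrix.one_apply, apply_ite mulOp, map_one, map_zero]
    rfl
  have h2 : (twist (-A)).map mulOp = 1 - M := by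
    ext1 t s
    rw [Matrix.map_apply, twist_apply, map_add, Matrix.sub_apply, Matrix.one_apply,
      Matrix.one_apply, apply_ite mulOp, map_one, map_zero, Matrix.neg_apply, C_neg, neg_mul,
      map_neg, sub_eq_add_neg]
    rfl
  have h3 : M * diagonal E * M = 0 := by
    ext1 t s
    rw [Matrix.mul_apply]
    refine Finset.sum_eq_zero fun p _ => ?_
    rw [mul_diagonal, hM, of_apply, of_apply]
    rcases mul_eq_zero.1 (hA s p t) with h | h
    · rw [h, C_0, zero_mul, map_zero, mul_zero]
    · rw [h, C_0, zero_mul, map_zero, zero_mul, zero_mul]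
  rw [h1, h2, mul_add, mul_one, sub_mul, one_mul, sub_mul, h3, sub_zero, Matrix.add_apply,
    Matrix.sub_apply, mul_diagonal, diagonal_mul, hM, of_apply]
  abel

lemma twistForm_twist_mulVec_eq {u : ι → ℂ[X] →ₗ[ℂ] ℂ} {τ τ' : Matrix ι ι ℂ[X]}
    (h : τ * τ' = 1) {E : ι → Module.End ℂ ℂ[X]} {D : Matrix ι ι (Module.End ℂ ℂ[X])}
    (hE : τ.map mulOp * D * τ'.map mulOp = diagonal E) {w w' : ι → ℂ[X]}
    (hw : ∀ v, twistForm u τ (opAct D v) w = twistForm u τ v w') (t : ι) (f : ℂ[X]) :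
    u t (E t f * (τ *ᵥ w) t) = u t (f * (τ *ᵥ w') t) := by
  have h1 := hw (τ' *ᵥ Pi.single t f)
  rw [twistForm_comm _ _ (τ' *ᵥ _), twistForm_mulVec_single h, mul_comm] at h1
  have e : τ *ᵥ opAct D (τ' *ᵥ Pi.single t f) = opAct (diagonal E) (Pi.single t f) := by
    rw [← hE, opAct_mul, opAct_mul, opAct_map_mulOp, opAct_map_mulOp]
  rw [← h1, twistForm_apply, Finset.sum_eq_single t]
  · rw [e, opAct_single, diagonal_apply_eq]
  · intro r _ hr
    rw [e, opAct_single, diagonal_apply_ne _ hr, LinearMap.zero_apply, zero_mul, map_zero]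
  · simp

/-- Structure of the operators that are symmetrizable with respect to a twisted form: after
undoing the twist they are diagonal, and their diagonal entries preserve degrees and have
degree-preserving adjoints. -/
lemma exists_diagonal {u : ι → ℂ[X] →ₗ[ℂ] ℂ}
    (hu : ∀ i, ∀ f : ℂ[X], u i (f * f.map (starRingEnd ℂ)) = 0 → f = 0)
    (hu' : ∀ i j, i ≠ j → ∀ e q, (∀ f, u i (f * e) = u j (f * q)) → e = 0)
    {A : Matrix ι ι ℂ} (hA : ∀ r s t, A r s * A s t = 0) {n : ℕ}
    {D : Matrix ι ι (Module.End ℂ ℂ[X])} (hDn : ∀ t s, commX^[n] (D t s) = 0)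
    (hD' : ∀ k, ∀ w : ι → ℂ[X], (∀ i, w i ∈ degreeLT ℂ k) → ∃ w' : ι → ℂ[X],
      (∀ i, w' i ∈ degreeLT ℂ k) ∧
        ∀ v, twistForm u (twist A) (opAct D v) w = twistForm u (twist A) v w') :
    (∀ t s, t ≠ s → D t s = D t t * mulOp (C (A s t) * X) - mulOp (C (A s t) * X) * D s s) ∧
    ∀ t k, ∀ g ∈ degreeLT ℂ k, ∃ h ∈ degreeLT ℂ k, ∀ f, u t (D t t f * g) = u t (f * h) := by
  have hτ := twist_mul_twist_neg hA
  have hτ' := twist_neg_mul_twist hA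
  have hAd : ∀ t, A t t = 0 := fun t => mul_self_eq_zero.1 (hA t t t)
  have hadj : ∀ w, ∃ w', ∀ v,
      twistForm u (twist A) (opAct D v) w = twistForm u (twist A) v w' := by
    intro w
    obtain ⟨k, hk⟩ := exists_forall_mem_degreeLT w
    obtain ⟨w', -, hw'⟩ := hD' k w hk
    exact ⟨w', hw'⟩
  obtain ⟨E, hE⟩ : ∃ E, (twist A).map mulOp * D * (twist (-A)).map mulOp = diagonal E := by
    refine ⟨fun t => ((twist A).map mulOp * D * (twist (-A)).map mulOp) t t, ?_⟩
    ext1 t s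
    rcases eq_or_ne t s with rfl | hts
    · rw [diagonal_apply_eq]
    · rw [diagonal_apply_ne _ hts]
      exact eq_zero_of_hasAdjoint (hu' t s hts) (hasAdjoint_conj hτ hadj t s)
        (iterate_commX_conj_eq_zero hDn _ _ t s)
  have hDE : D = (twist (-A)).map mulOp * diagonal E * (twist A).map mulOp := by
    have h1 : (twist (-A)).map mulOp * (twist A).map mulOp = 1 := by
      rw [← Matrix.map_mul, hτ']
      exact Matrix.map_one _ (map_zero _) (map_one _)
    rw [← hE]
    simp only [Matrix.mul_assoc, h1, Matrix.mul_one]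
    rw [← Matrix.mul_assoc, h1, Matrix.one_mul]
  have hform : ∀ t s, D t s = diagonal E t s + E t * mulOp (C (A s t) * X) -
      mulOp (C (A s t) * X) * E s := fun t s => by
    rw [← conj_diagonal_apply hA, ← hDE]
  have hdiag : ∀ t, D t t = E t := by
    intro t
    rw [hform, hAd, C_0, zero_mul, map_zero, zero_mul, mul_zero, add_zero, sub_zero,
      diagonal_apply_eq]
  refine ⟨fun t s hts => ?_, fun t k g hg => ?_⟩
  · rw [hform, diagonal_apply_ne _ hts, zero_add, hdiag, hdiag]
  · obtain ⟨w', hw'k, hw'⟩ := hD' k (Pi.single t g) fun i => by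
      rcases eq_or_ne i t with rfl | hi
      · rwa [Pi.single_eq_same]
      · rw [Pi.single_eq_of_ne hi]
        exact Submodule.zero_mem _
    have key := twistForm_twist_mulVec_eq hτ hE hw'
    have hsing : ∀ s, (twist A *ᵥ Pi.single t g) s =
        (Pi.single t g : ι → ℂ[X]) s + X * (C (A t s) * g) := by
      intro s
      rw [twist_mulVec_apply, Finset.sum_eq_single t]
      · rw [Pi.single_eq_same]
      · intro r _ hr
        rw [Pi.single_eq_of_ne hr, mul_zero]
      · simp
    have hw0 : ∀ s, C (A s t) * w' s = 0 := by
      intro s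
      rcases eq_or_ne (A s t) 0 with h0 | h0
      · rw [h0, C_0, zero_mul]
      · have hst : s ≠ t := by
          rintro rfl
          exact h0 (hAd s)
        have h1 : (twist A *ᵥ w') s = 0 := by
          refine hu s _ ?_
          rw [mul_comm, ← key, hsing, Pi.single_eq_of_ne hst,
            (mul_eq_zero.1 (hA s t s)).resolve_left h0]
          simp
        rw [twist_mulVec_apply, Finset.sum_eq_zero, mul_zero, add_zero] at h1
        · rw [h1, mul_zero]
        · intro r _
          rw [(mul_eq_zero.1 (hA r s t)).resolve_right h0, C_0, zero_mul]
    refine ⟨w' t, hw'k t, fun f => ?_⟩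
    have h1 := key t f
    rwa [hsing, Pi.single_eq_same, hAd, C_0, zero_mul, mul_zero, add_zero, twist_mulVec_apply,
      Finset.sum_eq_zero fun s _ => hw0 s, mul_zero, add_zero, ← hdiag] at h1

lemma X_mul_mem_degreeLT {k : ℕ} {f : ℂ[X]} (hf : f ∈ degreeLT ℂ k) :
    X * f ∈ degreeLT ℂ (k + 1) := by
  rw [mem_degreeLT, degree_lt_iff_coeff_zero] at hf ⊢
  intro m hm
  obtain ⟨d, rfl⟩ := Nat.exists_eq_succ_of_ne_zero (show m ≠ 0 by omega)
  rw [Nat.succ_eq_add_one, coeff_X_mul]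
  exact hf d (by omega)

lemma iterate_commX_mem_degreeLT {n j : ℕ} {E : Module.End ℂ ℂ[X]}
    (hE : ∀ k, ∀ f ∈ degreeLT ℂ k, E f ∈ degreeLT ℂ (k + j)) {k : ℕ} {f : ℂ[X]}
    (hf : f ∈ degreeLT ℂ k) : commX^[n] E f ∈ degreeLT ℂ (k + (j + n)) := by
  induction n generalizing E j with
  | zero => exact hE k f hf
  | succ n ih =>
    rw [Function.iterate_succ_apply, show j + (n + 1) = j + 1 + n by ring]
    refine ih fun k f hf => ?_
    rw [commX_apply]
    refine Submodule.sub_mem _ ?_ (X_mul_mem_degreeLT (hE k f hf))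
    have := hE _ _ (X_mul_mem_degreeLT hf)
    rwa [show k + 1 + j = k + (j + 1) by ring] at this

lemma coeff_one_sub_X_sq_pow (m : ℕ) : ((1 - X ^ 2 : ℂ[X]) ^ m).coeff (2 * m) = (-1) ^ m := by
  have h := coeff_pow_of_natDegree_le (p := (1 - X ^ 2 : ℂ[X])) (m := m) (n := 2) (by compute_degree)
  rw [mul_comm 2 m, h]
  congr 1
  simp [coeff_one]

/-- The leading coefficients of a degree-preserving matrix operator that is symmetrizable with
respect to a connected twist of Jacobi weights. -/
lemma leading_eq_scalar {α β : ι → ℝ} (hα : ∀ i, -1 < α i) (hβ : ∀ i, -1 < β i)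
    (hint : ∀ i j, i ≠ j →
      (¬ ∃ k : ℤ, α i - α j = (k : ℝ)) ∨ (¬ ∃ k : ℤ, β i - β j = (k : ℝ)))
    {A : Matrix ι ι ℂ} (hA : ∀ r s t, A r s * A s t = 0)
    (hconn : ∀ f : ι → ℂ, (∀ s t, A s t ≠ 0 → f s = f t) → ∀ s t, f s = f t)
    {n : ℕ} {e : ι → ι → ℕ → ℂ[X]} {D : Matrix ι ι (Module.End ℂ ℂ[X])}
    (hDe : ∀ t s, D t s = diffOp n (e t s)) (hne : ∃ t s, e t s n ≠ 0)
    (hD : ∀ k, ∀ v : ι → ℂ[X], (∀ i, v i ∈ degreeLT ℂ k) → ∀ i, opAct D v i ∈ degreeLT ℂ k)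
    (hD' : ∀ k, ∀ w : ι → ℂ[X], (∀ i, w i ∈ degreeLT ℂ k) → ∃ w' : ι → ℂ[X],
      (∀ i, w' i ∈ degreeLT ℂ k) ∧ ∀ v,
        twistForm (fun i => jacobiIntegral (hα i) (hβ i)) (twist A) (opAct D v) w =
          twistForm (fun i => jacobiIntegral (hα i) (hβ i)) (twist A) v w') :
    ∃ m, n = 2 * m ∧ ∃ c : ℂ, ∀ t s, e t s n = if t = s then C c * (1 - X ^ 2) ^ m else 0 := by
  have hu : ∀ i, ∀ f : ℂ[X],
      jacobiIntegral (hα i) (hβ i) (f * f.map (starRingEnd ℂ)) = 0 → f = 0 := fun i f h =>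
    eq_zero_of_re_jacobiIntegral_mul_conj (hα i) (hβ i) (by rw [h, Complex.zero_re])
  have hu' : ∀ i j, i ≠ j → ∀ e q, (∀ f, jacobiIntegral (hα i) (hβ i) (f * e) =
      jacobiIntegral (hα j) (hβ j) (f * q)) → e = 0 := fun i j hij e q h =>
    eq_zero_of_jacobiIntegral_mul_eq _ _ _ _ (hint j i hij.symm) h
  obtain ⟨hoff, hadj⟩ := exists_diagonal hu hu' hA (n := n + 1) (D := D)
    (fun t s => by rw [hDe, iterate_succ_commX_diffOp]) hD'
  have hpres : ∀ t s k, ∀ f ∈ degreeLT ℂ k, D t s f ∈ degreeLT ℂ k := by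
    intro t s k f hf
    rw [← opAct_single]
    refine hD k _ (fun i => ?_) t
    rcases eq_or_ne i s with rfl | hi
    · rwa [Pi.single_eq_same]
    · rw [Pi.single_eq_of_ne hi]
      exact Submodule.zero_mem _
  have hlead : ∀ t s, commX^[n] (D t s) = mulOp (n.factorial • e t s n) := fun t s => by
    rw [hDe, iterate_commX_diffOp]
  have hn0 : (n.factorial : ℂ) ≠ 0 := by exact_mod_cast n.factorial_ne_zero
  have hn1 : (n.factorial : ℂ[X]) ≠ 0 := by exact_mod_cast n.factorial_ne_zero
  have hode : ∀ t, e t t n ≠ 0 → ∃ m, n = 2 * m ∧ ∃ c : ℂ, e t t n = C c * (1 - X ^ 2) ^ m := by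
    intro t ht
    refine eq_pow_of_leading_eq ht ?_
    have hc := commute_of_symmetric (hu t) (hpres t t) (hadj t)
      (fun k f hf => jacobiOp_mem_degreeLT (α t) (β t) k hf)
      (jacobiIntegral_jacobiOp_mul (hα t) (hβ t))
    have h1 := leading_eq_of_commute_jacobiOp (hlead t t) hc
    rw [nsmul_eq_mul, derivative_natCast_mul] at h1
    refine mul_left_cancel₀ hn1 ?_
    linear_combination h1
  have hoffe : ∀ t s, t ≠ s → e t s n = C (A s t) * X * (e t t n - e s s n) := by
    intro t s hts
    have h1 := hlead t s
    rw [hoff t s hts, iterate_commX_sub, iterate_commX_mul_mulOp, iterate_commX_mulOp_mul, hlead,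
      hlead, ← map_mul, ← map_mul, ← map_sub] at h1
    have h2 := congrArg (fun T : Module.End ℂ ℂ[X] => T 1) h1
    simp only [mulOp_apply, mul_one, nsmul_eq_mul] at h2
    refine mul_left_cancel₀ hn1 ?_
    linear_combination -h2
  have hcoeff : ∀ s t, A s t ≠ 0 → (e s s n).coeff n = (e t t n).coeff n := by
    intro s t hst
    have hts : t ≠ s := by
      rintro rfl
      exact hst (mul_self_eq_zero.1 (hA t t t))
    have h0 : (1 : ℂ[X]) ∈ degreeLT ℂ 1 := by
      rw [mem_degreeLT, degree_one]
      exact_mod_cast Nat.zero_lt_one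
    have h1 := iterate_commX_mem_degreeLT (n := n) (j := 0) (hpres t s) h0
    rw [hlead, mulOp_apply, mul_one, hoffe t s hts, mem_degreeLT, degree_lt_iff_coeff_zero] at h1
    have h2 := h1 (n + 1) (by omega)
    rw [coeff_smul, mul_assoc, coeff_C_mul, coeff_X_mul, coeff_sub, nsmul_eq_mul] at h2
    have h3 := (mul_eq_zero.1 ((mul_eq_zero.1 h2).resolve_left hn0)).resolve_left hst
    exact (sub_eq_zero.1 h3).symm
  have hcoeff' := hconn _ hcoeff
  obtain ⟨t₀, ht₀⟩ : ∃ t, e t t n ≠ 0 := by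
    by_contra! h
    obtain ⟨t, s, hts⟩ := hne
    rcases eq_or_ne t s with rfl | hn
    · exact hts (h t)
    · exact hts (by rw [hoffe t s hn, h, h, sub_zero, mul_zero])
  obtain ⟨m, hm, c, hc⟩ := hode t₀ ht₀
  have hdiag : ∀ t, e t t n = C c * (1 - X ^ 2) ^ m := by
    intro t
    have h0 : (e t t n).coeff n = c * (-1) ^ m := by
      rw [hcoeff' t t₀, hc, coeff_C_mul, hm, coeff_one_sub_X_sq_pow]
    have hc0 : c ≠ 0 := by
      rintro rfl
      exact ht₀ (by rw [hc, C_0, zero_mul])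
    have hm1 : ((-1 : ℂ) ^ m) ≠ 0 := pow_ne_zero _ (by norm_num)
    have ht : e t t n ≠ 0 := by
      intro h
      rw [h, coeff_zero] at h0
      exact mul_ne_zero hc0 hm1 h0.symm
    obtain ⟨m', hm', c', hc'⟩ := hode t ht
    obtain rfl : m' = m := by omega
    rw [hc', coeff_C_mul, hm', coeff_one_sub_X_sq_pow] at h0
    rw [hc', mul_right_cancel₀ hm1 h0]
  refine ⟨m, hm, c, fun t s => ?_⟩
  split_ifs with h
  · rw [← h, hdiag]
  · rw [hoffe t s h, hdiag, hdiag, sub_self, mul_zero]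

lemma coeff_sum_smul_row {r : ℕ → ι → ι → ℂ[X]}
    (hr : ∀ k i p, (r k i p).coeff k = if p = i then 1 else 0) (k : ℕ) (c : ι → ℂ) (p : ι) :
    ((∑ i, c i • r k i) p).coeff k = c p := by
  simp [hr]

lemma mem_of_forall_row_mem {r : ℕ → ι → ι → ℂ[X]} (hr : ∀ k i p, r k i p ∈ degreeLT ℂ (k + 1))
    (hr' : ∀ k i p, (r k i p).coeff k = if p = i then 1 else 0) (W : Submodule ℂ (ι → ℂ[X]))
    {k : ℕ} (h : ∀ l < k, ∀ i, r l i ∈ W) {v : ι → ℂ[X]} (hv : ∀ i, v i ∈ degreeLT ℂ k) :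
    v ∈ W := by
  induction k generalizing v with
  | zero =>
    have : v = 0 := by
      ext1 i
      simpa [mem_degreeLT] using hv i
    rw [this]
    exact W.zero_mem
  | succ k ih =>
    have h1 : v - ∑ i, (v i).coeff k • r k i ∈ W := by
      refine ih (fun l hl => h l (by omega)) fun p => mem_degreeLT_of_succ ?_ ?_
      · rw [Pi.sub_apply, Finset.sum_apply]
        exact Submodule.sub_mem _ (hv p)
          (Submodule.sum_mem _ fun i _ => Submodule.smul_mem _ _ (hr k i p))
      · rw [Pi.sub_apply, coeff_sub, coeff_sum_smul_row hr', sub_self]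
    have h2 : ∑ i, (v i).coeff k • r k i ∈ W :=
      W.sum_mem fun i _ => W.smul_mem _ (h k (by omega) i)
    simpa using W.add_mem h1 h2

/-- An operator having an orthogonal family as eigenfunctions preserves degrees and has a
degree-preserving adjoint. -/
lemma exists_adjoint_of_eigen {B : (ι → ℂ[X]) →ₗ[ℂ] (ι → ℂ[X]) →ₗ[ℂ] ℂ}
    (hB : ∀ v, B v (conjVec v) = 0 → v = 0) {r : ℕ → ι → ι → ℂ[X]}
    (hr : ∀ k i p, r k i p ∈ degreeLT ℂ (k + 1))
    (hr' : ∀ k i p, (r k i p).coeff k = if p = i then 1 else 0)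
    (horth : ∀ k l, k ≠ l → ∀ i j, B (r k i) (conjVec (r l j)) = 0)
    {T : Module.End ℂ (ι → ℂ[X])} {Λ : ℕ → Matrix ι ι ℂ}
    (hT : ∀ k i, T (r k i) = ∑ m, Λ k i m • r k m) :
    (∀ k, ∀ v : ι → ℂ[X], (∀ i, v i ∈ degreeLT ℂ k) → ∀ i, T v i ∈ degreeLT ℂ k) ∧
    ∀ k, ∀ w : ι → ℂ[X], (∀ i, w i ∈ degreeLT ℂ k) → ∃ w' : ι → ℂ[X],
      (∀ i, w' i ∈ degreeLT ℂ k) ∧ ∀ v, B (T v) w = B v w' := by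
  have hmono : ∀ l k, l < k → ∀ i p, r l i p ∈ degreeLT ℂ k := fun l k hl i p =>
    degreeLT_mono (by omega) (hr l i p)
  refine ⟨fun k v hv => ?_, fun k w hw => ?_⟩
  · have := mem_of_forall_row_mem hr hr'
      (Submodule.comap T (Submodule.pi Set.univ fun _ => degreeLT ℂ k)) (fun l hl i => ?_) hv
    · simpa using this
    · rw [Submodule.mem_comap, hT]
      refine Submodule.sum_mem _ fun m _ => Submodule.smul_mem _ _ ?_
      simpa using hmono l k hl m
  · let W : Submodule ℂ (ι → ℂ[X]) :=
      { carrier := {w | ∃ w' : ι → ℂ[X], (∀ i, w' i ∈ degreeLT ℂ k) ∧ ∀ v, B (T v) w = B v w'}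
        zero_mem' := ⟨0, fun i => Submodule.zero_mem _, fun v => by rw [map_zero, map_zero]⟩
        add_mem' := by
          rintro w₁ w₂ ⟨w₁', h₁, e₁⟩ ⟨w₂', h₂, e₂⟩
          exact ⟨w₁' + w₂', fun i => Submodule.add_mem _ (h₁ i) (h₂ i), fun v => by
            rw [map_add, map_add, e₁, e₂]⟩
        smul_mem' := by
          rintro c w₁ ⟨w₁', h₁, e₁⟩
          exact ⟨c • w₁', fun i => Submodule.smul_mem _ _ (h₁ i), fun v => by
            rw [map_smul, map_smul, e₁]⟩ }
    refine mem_of_forall_row_mem (r := fun k i => conjVec (r k i))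
      (fun k i p => map_conj_mem_degreeLT (hr k i p)) (fun k i p => ?_) W (fun l hl j => ?_) hw
    · rw [conjVec, coeff_map, hr']
      split_ifs <;> simp
    set H : Matrix ι ι ℂ := of fun i m => B (r l i) (conjVec (r l m)) with hH
    have hdet : IsUnit H.det := by
      rw [isUnit_iff_ne_zero]
      intro h0
      obtain ⟨x, hx, hHx⟩ := exists_mulVec_eq_zero_iff.2 h0
      refine hx (funext fun p => ?_)
      have hz := hB (∑ i, (starRingEnd ℂ) (x i) • r l i) (by
        rw [conjVec_sum_smul, LinearMap.map_sum₂]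
        refine Finset.sum_eq_zero fun i _ => ?_
        have h1 := congrFun hHx i
        simp only [mulVec, dotProduct, hH, of_apply, Pi.zero_apply] at h1
        simp only [map_smul, LinearMap.smul_apply, map_sum, Complex.conj_conj, smul_eq_mul]
        rw [← mul_zero ((starRingEnd ℂ) (x i)), ← h1, Finset.mul_sum]
        exact Finset.sum_congr rfl fun m _ => by ring)
      have h1 := coeff_sum_smul_row hr' l (fun i => (starRingEnd ℂ) (x i)) p
      rw [hz] at h1
      simpa using h1.symm
    refine ⟨∑ m, (H⁻¹ * (Λ l * H)) m j • conjVec (r l m), fun i => ?_, fun v => ?_⟩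
    · rw [Finset.sum_apply]
      exact Submodule.sum_mem _ fun m _ => Submodule.smul_mem _ _
        (map_conj_mem_degreeLT (hmono l k hl m i))
    · have hcomp : H * (H⁻¹ * (Λ l * H)) = Λ l * H := by
        rw [← Matrix.mul_assoc, mul_nonsing_inv _ hdet, Matrix.one_mul]
      have hrow : ∀ k' i, B (T (r k' i)) (conjVec (r l j)) =
          B (r k' i) (∑ m, (H⁻¹ * (Λ l * H)) m j • conjVec (r l m)) := by
        intro k' i
        simp only [hT, map_sum, LinearMap.sum_apply, map_smul, LinearMap.smul_apply, smul_eq_mul]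
        rcases eq_or_ne k' l with rfl | hk
        · have := congrFun (congrFun hcomp i) j
          rw [Matrix.mul_apply, Matrix.mul_apply] at this
          simp only [hH, of_apply] at this
          rw [← this]
          exact Finset.sum_congr rfl fun m _ => mul_comm _ _
        · simp only [horth _ _ hk, mul_zero, Finset.sum_const_zero]
      obtain ⟨d, hd⟩ : ∃ d, ∀ i, v i ∈ degreeLT ℂ d := exists_forall_mem_degreeLT v
      have := mem_of_forall_row_mem hr hr' (LinearMap.ker
        ((B.flip (conjVec (r l j))) ∘ₗ T -
          B.flip (∑ m, (H⁻¹ * (Λ l * H)) m j • conjVec (r l m)))) (fun k' _ i => by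
            rw [LinearMap.mem_ker, LinearMap.sub_apply, sub_eq_zero]
            exact hrow k' i) hd
      rw [LinearMap.mem_ker, LinearMap.sub_apply, sub_eq_zero] at this
      exact this

end Operators

section MatrixPolynomials

variable {N : ℕ}

lemma symm_matPolyEquiv_derivative (P : Polynomial (Mat N)) (s t : Fin N) :
    matPolyEquiv.symm (derivative P) s t = derivative (matPolyEquiv.symm P s t) := by
  ext k
  rw [matPolyEquiv_symm_apply_coeff, coeff_derivative, coeff_derivative,
    matPolyEquiv_symm_apply_coeff, ← Nat.cast_succ, ← Nat.cast_succ, ← nsmul_eq_mul',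
    ← nsmul_eq_mul', Matrix.smul_apply]

lemma symm_matPolyEquiv_iterate_derivative (P : Polynomial (Mat N)) (j : ℕ) (s t : Fin N) :
    matPolyEquiv.symm ((fun Q : Polynomial (Mat N) => derivative Q)^[j] P) s t =
      (derivative ^ j : Module.End ℂ ℂ[X]) (matPolyEquiv.symm P s t) := by
  induction j with
  | zero => rfl
  | succ j ih =>
    rw [Function.iterate_succ_apply', symm_matPolyEquiv_derivative, ih, pow_succ',
      Module.End.mul_apply]

/-- The matrix of scalar differential operators describing the right action `applyOp` on rows. -/
def rowOp (F : ℕ → Polynomial (Mat N)) (n : ℕ) : Matrix (Fin N) (Fin N) (Module.End ℂ ℂ[X]) :=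
  of fun t s => diffOp n fun j => matPolyEquiv.symm (F j) s t

lemma opAct_rowOp (F : ℕ → Polynomial (Mat N)) (n : ℕ) (P : Polynomial (Mat N)) (s : Fin N) :
    opAct (rowOp F n) (matPolyEquiv.symm P s) = matPolyEquiv.symm (applyOp F n P) s := by
  ext1 t
  simp only [opAct_apply, rowOp, of_apply, diffOp, LinearMap.sum_apply, applyOp, map_sum,
    map_mul, Matrix.sum_apply, Module.End.mul_apply, mulOp_apply]
  rw [Finset.sum_comm]
  refine Finset.sum_congr rfl fun j _ => ?_
  rw [Matrix.mul_apply]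
  simp only [symm_matPolyEquiv_iterate_derivative, mul_comm]

lemma symm_matPolyEquiv_C_mul (Λ : Mat N) (P : Polynomial (Mat N)) (s : Fin N) :
    matPolyEquiv.symm (C Λ * P) s = ∑ m, Λ s m • matPolyEquiv.symm P m := by
  ext1 t
  rw [map_mul, matPolyEquiv_symm_C, Matrix.mul_apply, Finset.sum_apply]
  simp [smul_eq_C_mul]

lemma mval_apply (P : Polynomial (Mat N)) (x : ℝ) (s t : Fin N) :
    mval P x s t = (matPolyEquiv.symm P s t).eval (x : ℂ) := by
  rw [← matPolyEquiv_eval, AlgEquiv.apply_symm_apply, mval, Matrix.scalar_apply,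
    Matrix.smul_one_eq_diagonal]

lemma mval_mul_Tmat_apply (P : Polynomial (Mat N)) (a : ℕ → ℝ) (x : ℝ) (s i : Fin N) :
    (mval P x * Tmat N a x) s i =
      ((twist (Amat N a) *ᵥ matPolyEquiv.symm P s) i).eval (x : ℂ) := by
  rw [Tmat, mul_add, mul_one, mul_smul_comm, Matrix.add_apply, Matrix.smul_apply,
    Matrix.mul_apply, twist_mulVec_apply, eval_add, eval_mul, eval_X, eval_finsetSum, smul_eq_mul,
    mval_apply]
  simp only [eval_mul, eval_C, mval_apply, mul_comm]

lemma conjVec_twist_mulVec {A : Mat N} (hA : ∀ s t, (starRingEnd ℂ) (A s t) = A s t)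
    (v : Fin N → ℂ[X]) : conjVec (twist A *ᵥ v) = twist A *ᵥ conjVec v := by
  ext1 i
  simp only [conjVec, twist_mulVec_apply, Polynomial.map_add, Polynomial.map_mul, map_X,
    Polynomial.map_sum, map_C, hA]

lemma conj_Amat (a : ℕ → ℝ) (s t : Fin N) :
    (starRingEnd ℂ) (Amat N a s t) = Amat N a s t := by
  simp only [Amat, EU, Matrix.add_apply, Matrix.sum_apply, Matrix.smul_apply, of_apply, map_add,
    map_sum, smul_eq_mul, map_mul, Complex.conj_ofReal, apply_ite (starRingEnd ℂ), map_one,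
    map_zero]

lemma even_odd_of_Amat_ne_zero {a : ℕ → ℝ} {s t : Fin N} (h : Amat N a s t ≠ 0) :
    (s : ℕ) % 2 = 0 ∧ (t : ℕ) % 2 = 1 := by
  contrapose! h
  simp only [Amat, EU, Matrix.add_apply, Matrix.sum_apply, Matrix.smul_apply, of_apply]
  rw [Finset.sum_eq_zero, Finset.sum_eq_zero, add_zero]
  · intro j hj
    rw [Finset.mem_Icc] at hj
    rw [if_neg (by omega), smul_zero]
  · intro j hj
    rw [Finset.mem_Icc] at hj
    rw [if_neg (by omega), smul_zero]

lemma Amat_mul_Amat_apply (a : ℕ → ℝ) (r s t : Fin N) : Amat N a r s * Amat N a s t = 0 := by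
  by_contra h
  have h1 := even_odd_of_Amat_ne_zero (left_ne_zero_of_mul h)
  have h2 := even_odd_of_Amat_ne_zero (right_ne_zero_of_mul h)
  omega

lemma Amat_ne_zero {a : ℕ → ℝ} (ha : ∀ j, 1 ≤ j → j ≤ N - 1 → a j ≠ 0) {i : ℕ} (hi : i + 1 < N) :
    Amat N a ⟨i, by omega⟩ ⟨i + 1, hi⟩ ≠ 0 ∨ Amat N a ⟨i + 1, hi⟩ ⟨i, by omega⟩ ≠ 0 := by
  simp only [Amat, EU, Matrix.add_apply, Matrix.sum_apply, Matrix.smul_apply, of_apply]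
  rcases Nat.even_or_odd' i with ⟨l, rfl | rfl⟩
  · left
    rw [Finset.sum_eq_single (l + 1), Finset.sum_eq_zero, add_zero, if_pos (by omega)]
    · simpa using ha _ (by omega) (by omega)
    · intro j _
      rw [if_neg (by omega), smul_zero]
    · intro j _ hj
      rw [if_neg (by omega), smul_zero]
    · intro h
      rw [Finset.mem_Icc] at h
      omega
  · right
    rw [Finset.sum_eq_zero, Finset.sum_eq_single (l + 1), zero_add, if_pos (by omega)]
    · simpa using ha _ (by omega) (by omega)
    · intro j _ hj
      rw [if_neg (by omega), smul_zero]
    · intro h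
      rw [Finset.mem_Icc] at h
      omega
    · intro j hj
      rw [Finset.mem_Icc] at hj
      rw [if_neg (by omega), smul_zero]

lemma eq_of_forall_Amat_ne_zero {a : ℕ → ℝ} (ha : ∀ j, 1 ≤ j → j ≤ N - 1 → a j ≠ 0)
    {f : Fin N → ℂ} (hf : ∀ s t, Amat N a s t ≠ 0 → f s = f t) (s t : Fin N) : f s = f t := by
  have h0 : ∀ i (hi : i < N), f ⟨i, hi⟩ = f ⟨0, by omega⟩ := by
    intro i
    induction i with
    | zero => exact fun _ => rfl
    | succ i ih =>
      intro hi
      rw [← ih (by omega)]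
      rcases Amat_ne_zero ha hi with h | h
      · exact (hf _ _ h).symm
      · exact hf _ _ h
  rw [h0 s s.2, h0 t t.2]

lemma integral_mval_mul_WJ {a α β : ℕ → ℝ} (hα : ∀ i : Fin N, -1 < α (i + 1))
    (hβ : ∀ i : Fin N, -1 < β (i + 1)) (P Q : Polynomial (Mat N)) (s t : Fin N) :
    ∫ x in Set.Ioo (-1 : ℝ) 1, (mval P x * WJ N a α β x * (mval Q x)ᴴ) s t =
      twistForm (fun i => jacobiIntegral (hα i) (hβ i)) (twist (Amat N a))
        (matPolyEquiv.symm P s) (conjVec (matPolyEquiv.symm Q t)) := by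
  rw [twistForm_apply]
  simp only [jacobiIntegral_apply]
  rw [← integral_finsetSum _ fun i _ => integrableOn_eval_mul_jacobiWeight (hα i) (hβ i) _]
  refine integral_congr_ae (Filter.Eventually.of_forall fun x => ?_)
  have h1 : mval P x * WJ N a α β x * (mval Q x)ᴴ =
      (mval P x * Tmat N a x) * jacobiDiag N α β x * (mval Q x * Tmat N a x)ᴴ := by
    rw [WJ, conjTranspose_mul]
    simp only [Matrix.mul_assoc]
  simp only [h1]
  rw [Matrix.mul_apply]
  refine Finset.sum_congr rfl fun i _ => ?_
  rw [jacobiDiag, mul_diagonal, conjTranspose_apply, mval_mul_Tmat_apply, mval_mul_Tmat_apply,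
    eval_mul, ← conjVec_twist_mulVec (conj_Amat a), conjVec, eval_map_conj_ofReal, jacobiWeight]
  simp only [starRingEnd_apply]
  ring

lemma twistForm_conjVec_eq_zero {α β : Fin N → ℝ} (hα : ∀ i, -1 < α i) (hβ : ∀ i, -1 < β i)
    {A : Mat N} (hA : ∀ s t, (starRingEnd ℂ) (A s t) = A s t) (hA' : ∀ r s t, A r s * A s t = 0)
    {v : Fin N → ℂ[X]}
    (h : twistForm (fun i => jacobiIntegral (hα i) (hβ i)) (twist A) v (conjVec v) = 0) :
    v = 0 := by
  rw [twistForm_apply, ← conjVec_twist_mulVec hA] at h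
  simp only [conjVec] at h
  have h1 := congrArg Complex.re h
  rw [Complex.re_sum, Complex.zero_re, Finset.sum_eq_zero_iff_of_nonneg fun i _ =>
    re_jacobiIntegral_mul_conj_nonneg (hα i) (hβ i) _] at h1
  have h2 : twist A *ᵥ v = 0 := funext fun i =>
    eq_zero_of_re_jacobiIntegral_mul_conj (hα i) (hβ i) (h1 i (Finset.mem_univ i))
  rw [← one_mulVec v, ← twist_neg_mul_twist hA', ← mulVec_mulVec, h2, mulVec_zero]

lemma eq_C_smul_one_mul_pow {G : Polynomial (Mat N)} {c : ℂ} {m : ℕ}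
    (h : ∀ t s, matPolyEquiv.symm G s t = if t = s then C c * (1 - X ^ 2) ^ m else 0) :
    G = C (c • (1 : Mat N)) * (1 - X ^ 2) ^ m := by
  refine matPolyEquiv.symm.injective ?_
  rw [map_mul, map_pow, map_sub, map_one, map_pow, matPolyEquiv_symm_C, matPolyEquiv_symm_X,
    Matrix.smul_one_eq_diagonal, diagonal_map C_0, diagonal_pow, ← diagonal_one, diagonal_sub,
    diagonal_pow, diagonal_mul_diagonal]
  ext1 s t
  rw [h, diagonal_apply]
  rcases eq_or_ne s t with rfl | hst
  · simp
  · rw [if_neg hst.symm, if_neg hst]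

end MatrixPolynomials

/-- any differential operator (of order `n`, with nonzero leading coefficient
`F_n`) having the monic orthogonal polynomials of `W_J` as eigenfunctions has even order
`n = 2m`, and `F_n(x) = c (1−x²)ᵐ I` for some `c ∈ ℂ`. -/
theorem stmt10 (N : ℕ) (hN : 2 ≤ N) (a : ℕ → ℝ)
    (ha : ∀ j, 1 ≤ j → j ≤ N - 1 → a j ≠ 0)
    (α β : ℕ → ℝ)
    (hαβ : ∀ j, 1 ≤ j → j ≤ N → -1 < α j ∧ -1 < β j)
    (hsum : ∀ j, 1 ≤ j → j ≤ N → α 1 + β 1 = α j + β j + 1 + (-1 : ℝ) ^ j)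
    (hint : ∀ i j, 1 ≤ i → i ≤ N → 1 ≤ j → j ≤ N → i ≠ j →
      (¬ ∃ k : ℤ, α i - α j = (k : ℝ)) ∨ (¬ ∃ k : ℤ, β i - β j = (k : ℝ)))
    (P : ℕ → Polynomial (Mat N))
    (hdeg : ∀ n, (P n).natDegree = n)
    (hmonic : ∀ n, (P n).Monic)
    (horth : ∀ n m, n ≠ m → ∀ s t : Fin N,
      ∫ x in Set.Ioo (-1 : ℝ) 1, (mval (P n) x * WJ N a α β x * (mval (P m) x)ᴴ) s t = 0)
    (n : ℕ) (F : ℕ → Polynomial (Mat N)) (hFn : F n ≠ 0)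
    (heig : ∀ k : ℕ, ∃ Λ : Mat N, applyOp F n (P k) = Polynomial.C Λ * P k) :
    ∃ m : ℕ, n = 2 * m ∧
      ∃ c : ℂ, F n = Polynomial.C (c • (1 : Mat N)) * (1 - Polynomial.X ^ 2) ^ m := by
  have hα : ∀ i : Fin N, -1 < α (i + 1) := fun i => (hαβ _ (by omega) (by omega)).1
  have hβ : ∀ i : Fin N, -1 < β (i + 1) := fun i => (hαβ _ (by omega) (by omega)).2
  choose Λ hΛ using heig
  have hcoeff : ∀ k i p, (matPolyEquiv.symm (P k) i p).coeff k = if p = i then 1 else 0 := by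
    intro k i p
    have h1 : (P k).coeff k = 1 := by
      have := hmonic k
      rwa [Monic, leadingCoeff, hdeg] at this
    rw [matPolyEquiv_symm_apply_coeff, h1, Matrix.one_apply]
    simp only [eq_comm]
  have hdegree : ∀ k i p, matPolyEquiv.symm (P k) i p ∈ degreeLT ℂ (k + 1) := by
    intro k i p
    rw [mem_degreeLT, degree_lt_iff_coeff_zero]
    intro d hd
    rw [matPolyEquiv_symm_apply_coeff, coeff_eq_zero_of_natDegree_lt (by rw [hdeg]; omega),
      Matrix.zero_apply]
  obtain ⟨hD, hD'⟩ := exists_adjoint_of_eigen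
    (fun v => twistForm_conjVec_eq_zero hα hβ (conj_Amat a) (Amat_mul_Amat_apply a))
    hdegree hcoeff
    (fun k l hkl i j => by
      rw [← integral_mval_mul_WJ hα hβ]
      exact horth k l hkl i j)
    (T := opAct (rowOp F n)) (Λ := Λ)
    (fun k i => by rw [opAct_rowOp, hΛ, symm_matPolyEquiv_C_mul])
  obtain ⟨m, hm, c, hc⟩ := leading_eq_scalar hα hβ
    (fun i j hij => hint _ _ (by omega) (by omega) (by omega) (by omega) fun h =>
      hij (Fin.ext (by omega)))
    (Amat_mul_Amat_apply a) (fun f hf => eq_of_forall_Amat_ne_zero ha hf)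
    (e := fun t s j => matPolyEquiv.symm (F j) s t) (D := rowOp F n) (fun t s => rfl)
    (by
      by_contra! h
      refine hFn (matPolyEquiv.symm.injective ?_)
      rw [map_zero]
      ext1 s t
      exact h t s) hD hD'
  exact ⟨m, hm, c, eq_C_smul_one_mul_pow hc⟩
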